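/- arXiv:1712.03898 — 11 statements merged into one kernel-verified Lean document; each statement's English description precedes it below -/
import Mathlib

section
/- Let C be an [n,k] linear code over a finite field F. Suppose there exist n permutations π_1,…,π_n of {1,…,n}, each an automorphism of C, such that for every coordinate j ∈ {1,…,n} one has {π_1(j),…,π_n(j)} = {1,…,n} (i.e., i ↦ π_i(j) is a bijection). Then there exist n information sets I_1,…,I_n of C such that every coordinate j ∈ {1,…,n} belongs to exactly k of them; in particular, an MDS-PIR capacity-achieving matrix Λ_{k,n}(C) exists and C is an MDS-PIR capacity-achieving code. -/
open scoped Classical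

/-- `I` is an information set of the linear code `C ⊆ F^X`: it has size `dim C` and the
restriction map `C → F^I`, `c ↦ c|_I`, is injective. -/
def IsInformationSet {X F : Type*} [Fintype X] [Field F]
    (C : Submodule F (X → F)) (I : Finset X) : Prop :=
  I.card = Module.finrank F C ∧
    ∀ x y : C, (∀ i ∈ I, (x : X → F) i = (y : X → F) i) → x = y

/-- A PIR achievable rate matrix for `C` with column weight `κ`: a 0/1 matrix (rows indexed by
`R`, columns by `X`) whose every column has exactly `κ` ones and whose every row-support
contains an information set of `C`. -/
def IsPIRMatrix {R X F : Type*} [Fintype R] [Fintype X] [Field F]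
    (C : Submodule F (X → F)) (κ : ℕ) (Λ : R → X → Bool) : Prop :=
  (∀ j : X, (Finset.univ.filter fun i : R => Λ i j = true).card = κ) ∧
    ∀ i : R, ∃ I : Finset X, IsInformationSet C I ∧ ∀ j ∈ I, Λ i j = true

/-- An MDS-PIR capacity-achieving matrix: a PIR achievable rate matrix `Λ_{κ,ν}` with
`κ·n = k·ν` (where `n` is the code length and `k = dim C`). -/
def IsMDSPIRCapacityAchievingMatrix {R X F : Type*} [Fintype R] [Fintype X] [Field F]
    (C : Submodule F (X → F)) (κ : ℕ) (Λ : R → X → Bool) : Prop :=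
  IsPIRMatrix C κ Λ ∧ κ * Fintype.card X = Module.finrank F C * Fintype.card R

/-- `π` is an automorphism of the code `C`: the induced coordinate permutation
`(x_1,…,x_n) ↦ (x_{π(1)},…,x_{π(n)})` maps `C` onto `C`. -/
def IsCodeAut {n : ℕ} {F : Type*} [Field F] (C : Submodule F (Fin n → F))
    (π : Equiv.Perm (Fin n)) : Prop :=
  ∀ x : Fin n → F, x ∈ C ↔ (fun i => x (π i)) ∈ C

theorem IsInformationSet.of_vanishing {X F : Type*} [Fintype X] [Field F]
    {C : Submodule F (X → F)} {I : Finset X} (hcard : I.card ≤ Module.finrank F C)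
    (hI : ∀ x ∈ C, (∀ i ∈ I, x i = 0) → x = 0) : IsInformationSet C I := by
  have hinj : ∀ x y : C, (∀ i ∈ I, (x : X → F) i = (y : X → F) i) → x = y := by
    intro x y h
    have hz := hI _ (C.sub_mem x.2 y.2) fun i hi => by simp [h i hi]
    exact Subtype.ext (sub_eq_zero.mp hz)
  refine ⟨le_antisymm hcard ?_, hinj⟩
  let r : C →ₗ[F] (I → F) := (LinearMap.funLeft F F ((↑) : I → X)).comp C.subtype
  have hr : Function.Injective r := fun x y h =>
    hinj x y fun i hi => congrFun h ⟨i, hi⟩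
  simpa using LinearMap.finrank_le_finrank_of_injective hr

theorem exists_isInformationSet {X F : Type*} [Fintype X] [Field F]
    (C : Submodule F (X → F)) : ∃ I : Finset X, IsInformationSet C I := by
  let v : X → Module.Dual F C := fun j => (LinearMap.proj j).comp C.subtype
  obtain ⟨κ, a, ha, hspan, hli⟩ := exists_linearIndependent' F v
  have : Finite κ := Finite.of_injective a ha
  have := Fintype.ofFinite κ
  refine ⟨Finset.univ.image a, .of_vanishing ?_ ?_⟩
  · rw [Finset.card_image_of_injective _ ha, Finset.card_univ, ← Subspace.dual_finrank_eq]
    exact hli.fintype_card_le_finrank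
  · intro x hx h
    have hle : Submodule.span F (Set.range v) ≤
        LinearMap.ker (Module.Dual.eval F C ⟨x, hx⟩) := by
      rw [← hspan, Submodule.span_le]
      rintro _ ⟨t, rfl⟩
      exact h (a t) (Finset.mem_image_of_mem a (Finset.mem_univ t))
    funext j
    exact hle (Submodule.subset_span ⟨j, rfl⟩)

theorem IsInformationSet.map_codeAut {n : ℕ} {F : Type*} [Field F]
    {C : Submodule F (Fin n → F)} {I : Finset (Fin n)} (hI : IsInformationSet C I)
    {σ : Equiv.Perm (Fin n)} (hσ : IsCodeAut C σ) :
    IsInformationSet C (I.map σ.toEmbedding) := by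
  refine ⟨by rw [Finset.card_map, hI.1], fun x y h => ?_⟩
  have hxy := hI.2 ⟨_, (hσ x).1 x.2⟩ ⟨_, (hσ y).1 y.2⟩ fun i hi =>
    h (σ i) (Finset.mem_map_of_mem σ.toEmbedding hi)
  refine Subtype.ext (funext fun j => ?_)
  simpa using congrFun (congrArg Subtype.val hxy) (σ.symm j)

theorem card_filter_mem_map_of_bijective {R X : Type*} [Fintype R]
    (π : R → Equiv.Perm X) (hπ : ∀ j : X, Function.Bijective fun i : R => π i j)
    (I : Finset X) (j : X) :
    (Finset.univ.filter fun i : R => j ∈ I.map (π i).toEmbedding).card = I.card := by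
  refine Finset.card_bij (fun i _ => (π i).symm j) ?_ ?_ ?_
  · intro i hi
    obtain ⟨t, ht, rfl⟩ := Finset.mem_map.mp (Finset.mem_filter.mp hi).2
    simpa using ht
  · intro i _ i' _ h
    refine (hπ ((π i).symm j)).1 ?_
    change π i ((π i).symm j) = π i' ((π i).symm j)
    rw [Equiv.apply_symm_apply, h, Equiv.apply_symm_apply]
  · intro t ht
    obtain ⟨i, hi⟩ := (hπ t).2 j
    refine ⟨i, Finset.mem_filter.mpr ⟨Finset.mem_univ i, Finset.mem_map.mpr ⟨t, ht, hi⟩⟩, ?_⟩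
    exact (π i).symm_apply_eq.mpr hi.symm

/-- If an `[n,k]` code `C` has `n` automorphisms `π_1,…,π_n` such that for every
coordinate `j` the map `i ↦ π_i(j)` is a bijection of `{1,…,n}`, then there exist `n` information
sets of `C` such that every coordinate belongs to exactly `k` of them; in particular an MDS-PIR
capacity-achieving matrix `Λ_{k,n}(C)` exists. -/
theorem code_auts_give_mds_pir_matrix {F : Type*} [Field F] [Fintype F] {n k : ℕ}
    (C : Submodule F (Fin n → F)) (hk : Module.finrank F C = k)
    (π : Fin n → Equiv.Perm (Fin n)) (haut : ∀ i, IsCodeAut C (π i))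
    (htrans : ∀ j : Fin n, Function.Bijective fun i : Fin n => π i j) :
    (∃ I : Fin n → Finset (Fin n), (∀ i, IsInformationSet C (I i)) ∧
      ∀ j : Fin n, (Finset.univ.filter fun i : Fin n => j ∈ I i).card = k) ∧
    ∃ Λ : Fin n → Fin n → Bool, IsMDSPIRCapacityAchievingMatrix C k Λ := by
  obtain ⟨I, hI⟩ := exists_isInformationSet C
  have hinfo : ∀ i, IsInformationSet C (I.map (π i).toEmbedding) := fun i =>
    hI.map_codeAut (haut i)
  have hcount : ∀ j : Fin n,
      (Finset.univ.filter fun i : Fin n => j ∈ I.map (π i).toEmbedding).card = k := fun j => by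
    rw [← hk, ← hI.1]
    convert card_filter_mem_map_of_bijective π htrans I j
  refine ⟨⟨_, hinfo, fun j => by convert hcount j⟩,
    fun i j => decide (j ∈ I.map (π i).toEmbedding), ⟨fun j => ?_, fun i => ?_⟩, by rw [hk]⟩
  · rw [← hcount j]
    congr 1
    ext i
    simp
  · exact ⟨_, hinfo i, fun j hj => decide_eq_true hj⟩
end

section
/- Let C be an [n,k] linear code over a finite field F for which an MDS-PIR capacity-achieving matrix Λ_{κ,ν} exists. Then the dual code C^⊥ is an [n,n−k] code and the entrywise binary complement of Λ (replacing every 0 by 1 and every 1 by 0) is an MDS-PIR capacity-achieving matrix Λ_{ν−κ,ν} for C^⊥; in particular, the dual of an [n,k] MDS-PIR capacity-achieving code is an [n,n−k] MDS-PIR capacity-achieving code. -/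
open scoped Classical

/-- The dual code `C^⊥ = {y : Σ_j x_j y_j = 0 for all x ∈ C}`. -/
def dualCode {n : ℕ} {F : Type*} [Field F] (C : Submodule F (Fin n → F)) :
    Submodule F (Fin n → F) where
  carrier := {y | ∀ x ∈ C, ∑ j, x j * y j = 0}
  zero_mem' := by intro x _; simp
  add_mem' := by
    intro a b ha hb x hx
    have h : ∑ j, x j * (a + b) j = (∑ j, x j * a j) + ∑ j, x j * b j := by
      rw [← Finset.sum_add_distrib]
      exact Finset.sum_congr rfl fun j _ => by simp [mul_add]
    simp only [Set.mem_setOf_eq] at *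
    rw [h, ha x hx, hb x hx, add_zero]
  smul_mem' := by
    intro c a ha x hx
    have h : ∑ j, x j * (c • a) j = c * ∑ j, x j * a j := by
      rw [Finset.mul_sum]
      exact Finset.sum_congr rfl fun j _ => by simp [smul_eq_mul]; ring
    simp only [Set.mem_setOf_eq] at *
    rw [h, ha x hx, mul_zero]

theorem finrank_add_finrank_dualCode {n : ℕ} {F : Type*} [Field F]
    (C : Submodule F (Fin n → F)) :
    Module.finrank F C + Module.finrank F (dualCode C) = n := by
  have h : dualCode C =
      (C.map (dotProductEquiv F (Fin n)).toLinearMap).dualCoannihilator := by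
    ext y
    rw [Submodule.mem_dualCoannihilator]
    exact (Set.forall_mem_image (f := dotProductEquiv F (Fin n)) (s := C)
      (p := fun φ => φ y = 0)).symm
  have hsum := Subspace.finrank_add_finrank_dualCoannihilator_eq
    (C.map (dotProductEquiv F (Fin n)).toLinearMap)
  rwa [← h, LinearEquiv.finrank_map_eq, Module.finrank_fin_fun] at hsum

/-- Every vector on an information set extends to a codeword. -/
theorem IsInformationSet.exists_extension {X F : Type*} [Fintype X] [Field F]
    {C : Submodule F (X → F)} {I : Finset X} (hI : IsInformationSet C I) (v : I → F) :
    ∃ x ∈ C, ∀ i : I, x i = v i := by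
  let f : C →ₗ[F] (I → F) := LinearMap.funLeft F F Subtype.val ∘ₗ C.subtype
  have hinj : Function.Injective f := fun x y hxy =>
    hI.2 x y fun i hi => congrFun hxy ⟨i, hi⟩
  have hdim : Module.finrank F C = Module.finrank F (I → F) := by
    simp [← hI.1]
  obtain ⟨x, hx⟩ := (LinearMap.injective_iff_surjective_of_finrank_eq_finrank hdim).1 hinj v
  exact ⟨x, x.2, fun i => congrFun hx i⟩

theorem IsInformationSet.compl_dualCode {n : ℕ} {F : Type*} [Field F]
    {C : Submodule F (Fin n → F)} {I : Finset (Fin n)} (hI : IsInformationSet C I) :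
    IsInformationSet (dualCode C) Iᶜ := by
  refine ⟨?_, fun y z hyz => Subtype.ext (funext fun i => ?_)⟩
  · have hdim := finrank_add_finrank_dualCode C
    rw [Finset.card_compl, Fintype.card_fin, hI.1]
    omega
  · by_cases hi : i ∈ I
    · obtain ⟨x, hx, hxI⟩ := hI.exists_extension (Pi.single ⟨i, hi⟩ 1)
      have hd : ∑ j, x j * (y - z : dualCode C).1 j = 0 := (y - z).2 x hx
      rw [Finset.sum_eq_single i] at hd
      · have hxi : x i = 1 := by simpa using hxI ⟨i, hi⟩
        simpa [hxi, sub_eq_zero] using hd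
      · intro j _ hji
        by_cases hj : j ∈ I
        · have hxj : x j = 0 := by simpa [Pi.single_apply, hji] using hxI ⟨j, hj⟩
          simp [hxj]
        · simp [hyz j (Finset.mem_compl.2 hj)]
      · simp
    · exact hyz i (Finset.mem_compl.2 hi)

/-- When `κ n = ν dim C`, the support of each row of a PIR matrix is an information set. -/
theorem IsPIRMatrix.isInformationSet_row {R X F : Type*} [Fintype R] [Fintype X] [Field F]
    {C : Submodule F (X → F)} {κ : ℕ} {Λ : R → X → Bool} (hΛ : IsPIRMatrix C κ Λ)
    (hach : κ * Fintype.card X = Module.finrank F C * Fintype.card R) (i : R) :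
    IsInformationSet C (Finset.univ.filter fun j => Λ i j = true) := by
  choose I hI hIΛ using hΛ.2
  have hsub : ∀ i, I i ⊆ Finset.univ.filter fun j => Λ i j = true := fun i j hj =>
    Finset.mem_filter.2 ⟨Finset.mem_univ j, hIΛ i j hj⟩
  have hsum : ∑ i, (I i).card =
      ∑ i, (Finset.univ.filter fun j => Λ i j = true).card := by
    have hdouble := Finset.sum_card_bipartiteAbove_eq_sum_card_bipartiteBelow
      (s := (Finset.univ : Finset R)) (t := (Finset.univ : Finset X))
      (fun i j => Λ i j = true)
    simp only [Finset.bipartiteAbove, Finset.bipartiteBelow] at hdouble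
    rw [hdouble, Finset.sum_congr rfl fun i _ => (hI i).1,
      Finset.sum_congr rfl fun j _ => hΛ.1 j]
    simp only [Finset.sum_const, Finset.card_univ, smul_eq_mul]
    linarith
  have hcard := (Finset.sum_eq_sum_iff_of_le fun i _ => Finset.card_le_card (hsub i)).1 hsum i
    (Finset.mem_univ i)
  rw [← Finset.eq_of_subset_of_card_le (hsub i) hcard.ge]
  exact hI i

/-- If `Λ_{κ,ν}` is an MDS-PIR capacity-achieving matrix for an `[n,k]` code
`C`, then the dual code `C^⊥` is an `[n,n−k]` code and the entrywise binary complement of `Λ` is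
an MDS-PIR capacity-achieving matrix `Λ_{ν−κ,ν}` for `C^⊥`. -/
theorem dual_of_mds_pir_capacity_achieving {F : Type*} [Field F] [Fintype F] {n k ν κ : ℕ}
    (C : Submodule F (Fin n → F)) (hk : Module.finrank F C = k)
    (Λ : Fin ν → Fin n → Bool) (hΛ : IsPIRMatrix C κ Λ) (hach : κ * n = k * ν) :
    Module.finrank F (dualCode C) = n - k ∧
      IsPIRMatrix (dualCode C) (ν - κ) (fun i j => !Λ i j) ∧
      (ν - κ) * n = (n - k) * ν := by
  have hdim := finrank_add_finrank_dualCode C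
  refine ⟨by omega, ⟨fun j => ?_, fun i => ?_⟩, ?_⟩
  · have hcompl := Finset.card_filter_add_card_filter_not
      (s := (Finset.univ : Finset (Fin ν))) fun i => Λ i j = true
    rw [hΛ.1 j, Finset.card_univ, Fintype.card_fin] at hcompl
    simp only [Bool.not_eq_true']
    simp only [Bool.not_eq_true] at hcompl
    omega
  · refine ⟨_, (hΛ.isInformationSet_row (by simpa [hk] using hach) i).compl_dualCode, ?_⟩
    simp
  · rw [Nat.sub_mul, Nat.sub_mul, hach, mul_comm ν n]
end

section
/- Let C ⊆ F^n be a k-dimensional linear code over a finite field F that is cyclic, i.e., invariant under the cyclic shift of coordinates (x_1,…,x_n) ↦ (x_n,x_1,…,x_{n−1}). Then there exist n information sets I_1,…,I_n of C such that every coordinate belongs to exactly k of them; in particular, an MDS-PIR capacity-achieving matrix Λ_{k,n}(C) exists and every cyclic code is an MDS-PIR capacity-achieving code. -/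
open scoped Classical

/-- If a code is invariant under permuting coordinates by `σ`, then `σ⁻¹` carries information
sets to information sets. -/
theorem IsInformationSet.map_symm {X F : Type*} [Fintype X] [Field F]
    {C : Submodule F (X → F)} {I : Finset X} (hI : IsInformationSet C I) (σ : Equiv.Perm X)
    (hσ : ∀ x ∈ C, (fun i => x (σ.symm i)) ∈ C) :
    IsInformationSet C (I.map σ.symm.toEmbedding) := by
  refine ⟨by rw [Finset.card_map, hI.1], fun x y h => ?_⟩
  have hxy := hI.2 ⟨_, hσ x x.2⟩ ⟨_, hσ y y.2⟩ fun i hi =>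
    h (σ.symm i) (Finset.mem_map_of_mem σ.symm.toEmbedding hi)
  ext j
  simpa using congrFun (congrArg Subtype.val hxy) (σ j)

open scoped Fin.CommRing in
/-- All cyclic translates of an information set of a cyclic code are information sets. -/
theorem IsInformationSet.filter_add_natCast {F : Type*} [Field F] {n : ℕ}
    {C : Submodule F (Fin (n + 1) → F)} {I : Finset (Fin (n + 1))} (hI : IsInformationSet C I)
    (hcyc : ∀ x ∈ C, (fun i => x ((finRotate (n + 1)).symm i)) ∈ C) (m : ℕ) :
    IsInformationSet C (Finset.univ.filter fun j => j + (m : Fin (n + 1)) ∈ I) := by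
  induction m with
  | zero => simpa using hI
  | succ m ih =>
    convert ih.map_symm (finRotate (n + 1)) hcyc using 1
    ext j
    rw [Finset.mem_map_equiv]
    simp [add_comm, add_left_comm]

/-- If a `k`-dimensional code `C ⊆ F^n` is cyclic, i.e. invariant under the
cyclic shift `(x_1,…,x_n) ↦ (x_n,x_1,…,x_{n−1})` (the shifted word takes at position `i` the
value of `x` at position `i−1`, cyclically), then there exist `n` information sets of `C` such
that every coordinate belongs to exactly `k` of them; in particular an MDS-PIR
capacity-achieving matrix `Λ_{k,n}(C)` exists. -/
theorem cyclic_code_mds_pir_capacity_achieving {F : Type*} [Field F] [Fintype F] {n k : ℕ}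
    (C : Submodule F (Fin n → F)) (hk : Module.finrank F C = k)
    (hcyc : ∀ x ∈ C, (fun i : Fin n => x ((finRotate n).symm i)) ∈ C) :
    (∃ I : Fin n → Finset (Fin n), (∀ i, IsInformationSet C (I i)) ∧
      ∀ j : Fin n, (Finset.univ.filter fun i : Fin n => j ∈ I i).card = k) ∧
    ∃ Λ : Fin n → Fin n → Bool, IsMDSPIRCapacityAchievingMatrix C k Λ := by
  have key : ∃ I : Fin n → Finset (Fin n), (∀ i, IsInformationSet C (I i)) ∧
      ∀ j : Fin n, (Finset.univ.filter fun i : Fin n => j ∈ I i).card = k := by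
    obtain ⟨I, hI⟩ := exists_isInformationSet C
    cases n with
    | zero => exact ⟨fun _ => I, fun _ => hI, fun j => j.elim0⟩
    | succ n =>
      refine ⟨fun i => Finset.univ.filter fun j => j + i ∈ I, fun i => ?_, fun j => ?_⟩
      · simpa using hI.filter_add_natCast hcyc i
      · rw [← hk, ← hI.1, ← Finset.card_map (Equiv.addLeft j).toEmbedding]
        congr 1
        ext i
        rw [Finset.mem_map_equiv]
        simp
  refine ⟨key, ?_⟩
  obtain ⟨I, hI, hcount⟩ := key
  exact ⟨fun i j => decide (j ∈ I i), ⟨by simpa using hcount, fun i => ⟨I i, hI i, by simp⟩⟩,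
    by rw [hk, Fintype.card_fin]⟩
end

section
/- Let C be a nonzero [n,k] linear code over a finite field F with minimum Hamming distance d = d_min^C. Then there exists a PIR achievable rate matrix Λ_{k,ν}(C) with ν = k + min(k, d−1): a ν×n matrix with entries in {0,1} in which every column has exactly k ones and the support of every row contains an information set of C. -/
open scoped Classical

theorem exists_isInformationSet_subset {X F : Type*} [Fintype X] [Field F]
    (C : Submodule F (X → F)) (S : Finset X)
    (hS : ∀ x ∈ C, (∀ i ∈ S, x i = 0) → x = 0) :
    ∃ I ⊆ S, IsInformationSet C I := by
  let f : S → Module.Dual F C := fun i => (LinearMap.proj i.1).comp C.subtype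
  have hf : Submodule.span F (Set.range f) = ⊤ := by
    rw [← Subspace.dualCoannihilator_dualAnnihilator_eq (W := Submodule.span F (Set.range f))]
    suffices h : (Submodule.span F (Set.range f)).dualCoannihilator = ⊥ by
      rw [h, Submodule.dualAnnihilator_bot]
    refine (Submodule.eq_bot_iff _).2 fun x hx => ?_
    rw [Submodule.mem_dualCoannihilator] at hx
    exact Subtype.ext (hS x x.2 fun i hi => hx (f ⟨i, hi⟩) (Submodule.subset_span ⟨_, rfl⟩))
  obtain ⟨κ, a, ha, hspan, hli⟩ := exists_linearIndependent' F f
  have : Fintype κ := Fintype.ofInjective a ha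
  rw [hf] at hspan
  have hinj : Function.Injective fun t => (a t : X) := Subtype.val_injective.comp ha
  refine ⟨Finset.univ.map ⟨_, hinj⟩, ?_, ?_, ?_⟩
  · intro i hi
    obtain ⟨t, -, rfl⟩ := Finset.mem_map.1 hi
    exact (a t).2
  · rw [Finset.card_map, Finset.card_univ, ← Subspace.dual_finrank_eq (V := C),
      Module.finrank_eq_card_basis (Module.Basis.mk hli hspan.ge)]
  · intro x y hxy
    refine sub_eq_zero.1 ((Module.forall_dual_apply_eq_zero_iff F (x - y)).1 fun φ => ?_)
    rw [map_sub, sub_eq_zero]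
    have hφ : φ ∈ Submodule.span F (Set.range (f ∘ a)) := hspan ▸ Submodule.mem_top
    induction hφ using Submodule.span_induction with
    | mem φ h =>
      obtain ⟨t, rfl⟩ := h
      exact hxy (a t) (Finset.mem_map_of_mem _ (Finset.mem_univ t))
    | zero => rfl
    | add φ ψ _ _ h₁ h₂ => simp [h₁, h₂]
    | smul c φ _ h => simp [h]

theorem exists_isInformationSet_disjoint {X F : Type*} [Fintype X] [Field F] {d : ℕ}
    (C : Submodule F (X → F)) (hd : ∀ x ∈ C, x ≠ 0 → d ≤ hammingNorm x)
    (Z : Finset X) (hZ : Z.card < d) :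
    ∃ I, Disjoint I Z ∧ IsInformationSet C I := by
  obtain ⟨I, hI, h⟩ := exists_isInformationSet_subset C Zᶜ fun x hx h0 => by
    by_contra hne
    refine (hd x hx hne).not_gt (lt_of_le_of_lt (Finset.card_le_card fun i hi => ?_) hZ)
    by_contra hiZ
    exact (Finset.mem_filter.1 hi).2 (h0 i (Finset.mem_compl.2 hiZ))
  exact ⟨I, Finset.disjoint_left.2 fun i hi => Finset.mem_compl.1 (hI hi), h⟩

theorem card_filter_add_val_lt {k m : ℕ} [NeZero k] (hm : m ≤ k) (a : Fin k) :
    (Finset.univ.filter fun i : Fin k => (a + i).val < m).card = m := by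
  have h := Fintype.card_congr ((Equiv.addLeft a).subtypeEquiv
    (p := fun i : Fin k => (a + i).val < m) (q := fun i : Fin k => i.val < m) fun i => Iff.rfl)
  rw [← Fintype.card_subtype, h, Fintype.card_subtype, Fin.card_filter_val_lt, min_eq_right hm]

/-- Let `C` be a nonzero `[n,k]` code with minimum Hamming distance `d`
(`d` is the least Hamming weight of a nonzero codeword).  Then a PIR achievable rate matrix
`Λ_{k,ν}(C)` with `ν = k + min k (d−1)` exists: a `ν×n` 0/1 matrix whose every column has
exactly `k` ones and whose every row-support contains an information set of `C`. -/
theorem exists_pir_achievable_rate_matrix {F : Type*} [Field F] [Fintype F] {n k d : ℕ}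
    (C : Submodule F (Fin n → F)) (hk : Module.finrank F C = k)
    (hd : IsLeast {w : ℕ | ∃ x ∈ C, x ≠ 0 ∧ hammingNorm x = w} d) :
    ∃ Λ : Fin (k + min k (d - 1)) → Fin n → Bool, IsPIRMatrix C k Λ := by
  obtain ⟨⟨x₀, hx₀, hne, hw⟩, hmin⟩ := hd
  have hdpos : 0 < d := hw ▸ hammingNorm_pos_iff.2 hne
  have hkpos : 0 < k := by
    rw [← hk, Module.finrank_pos_iff]
    exact ⟨⟨x₀, hx₀⟩, 0, fun h => hne (congrArg Subtype.val h)⟩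
  have : NeZero k := ⟨hkpos.ne'⟩
  have hmk : min k (d - 1) ≤ k := min_le_left _ _
  have hmd : min k (d - 1) < d := by omega
  generalize min k (d - 1) = m at hmk hmd ⊢
  obtain ⟨I, -, hI⟩ := exists_isInformationSet_disjoint C
    (fun x hx h => hmin ⟨x, hx, h, rfl⟩) ∅ (by simpa)
  let e : I ≃ Fin k := I.equivFinOfCardEq (hI.1.trans hk)
  -- `m` rows supported on `I`, and `k` rows omitting cyclic intervals of length `m` in `I`
  refine ⟨Fin.addCases (fun i j => decide (¬ ∃ h : j ∈ I, (e ⟨j, h⟩ + i).val < m))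
    (fun _ j => decide (j ∈ I)), fun j => ?_, fun i => ?_⟩
  · rw [Finset.card_filter, Fin.sum_univ_add]
    by_cases hj : j ∈ I
    · have hc := card_filter_add_val_lt hmk (e ⟨j, hj⟩)
      have hs := Finset.card_filter_add_card_filter_not (s := Finset.univ)
        fun i : Fin k => (e ⟨j, hj⟩ + i).val < m
      rw [hc, Finset.card_univ, Fintype.card_fin, Finset.card_filter] at hs
      simp only [Fin.addCases_left, Fin.addCases_right, hj, exists_true_left, decide_eq_true_eq]
      simp only [if_true, Finset.sum_const, Finset.card_univ, Fintype.card_fin, smul_eq_mul,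
        mul_one]
      omega
    · simp [hj]
  · induction i using Fin.addCases with
    | right i => exact ⟨I, hI, fun j hj => by simpa using hj⟩
    | left i =>
      let Z := (Finset.univ.filter fun a : Fin k => (i + a).val < m).map
        (e.symm.toEmbedding.trans (Function.Embedding.subtype _))
      obtain ⟨J, hJ, hJ'⟩ := exists_isInformationSet_disjoint C
        (fun x hx h => hmin ⟨x, hx, h, rfl⟩) Z
        (by rwa [Finset.card_map, card_filter_add_val_lt hmk])
      refine ⟨J, hJ', fun j hj => ?_⟩
      simp only [Fin.addCases_left, decide_eq_true_eq]
      rintro ⟨h, hlt⟩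
      refine Finset.disjoint_left.1 hJ hj (Finset.mem_map.2 ⟨e ⟨j, h⟩, ?_, by simp⟩)
      simpa [add_comm] using hlt
end

section
/- For integers m ≥ 0 and 0 ≤ v ≤ m, let I = {μ ∈ GF(2)^m : wt(μ) ≤ v}. Then the restriction map R(v,m) → (I → GF(2)), f ↦ f|_I, is a linear bijection. In particular, I is an information set of R(v,m), and dim R(v,m) = |I| = Σ_{i=0}^v binom(m,i). Equivalently, if a polynomial f over GF(2) in m variables with total degree at most v vanishes at every point of GF(2)^m of Hamming weight at most v, then f vanishes at every point of GF(2)^m. -/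
open scoped Classical

/-- The linear map sending a polynomial in `m` variables over `GF(2)` to its evaluation
function `GF(2)^m → GF(2)`. -/
noncomputable def evalLM (m : ℕ) :
    MvPolynomial (Fin m) (ZMod 2) →ₗ[ZMod 2] ((Fin m → ZMod 2) → ZMod 2) where
  toFun f := fun μ => MvPolynomial.eval μ f
  map_add' f g := by funext μ; simp
  map_smul' c f := by funext μ; simp [MvPolynomial.smul_eval]

/-- The `v`-th order binary Reed–Muller code `R(v,m)`: the space of evaluation maps of
`m`-variable polynomials over `GF(2)` of total degree at most `v`, with coordinates indexed by
the points of `GF(2)^m`. -/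
noncomputable def RM (v m : ℕ) : Submodule (ZMod 2) ((Fin m → ZMod 2) → ZMod 2) :=
  (MvPolynomial.restrictTotalDegree (Fin m) (ZMod 2) v).map (evalLM m)

/-- The set `I = {μ ∈ GF(2)^m : wt(μ) ≤ v}` of points of Hamming weight at most `v`. -/
def lowWeightSet (v m : ℕ) : Finset (Fin m → ZMod 2) :=
  Finset.univ.filter fun μ => hammingNorm μ ≤ v

theorem natCast_card_Icc_finset {α : Type*} [DecidableEq α] (s t : Finset α) :
    ((Finset.Icc s t).card : ZMod 2) = if s = t then 1 else 0 := by
  split_ifs with h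
  · simp [h]
  · by_cases hst : s ⊆ t
    · have hlt := Finset.card_lt_card (hst.ssubset_of_ne h)
      rw [Finset.card_Icc_finset hst, Nat.cast_pow, Nat.cast_two, show (2 : ZMod 2) = 0 from rfl,
        zero_pow (by omega)]
    · rw [Finset.Icc_eq_empty hst, Finset.card_empty, Nat.cast_zero]

/-- Binary vectors correspond to subsets of the coordinates via their supports. -/
def indicatorEquiv (m : ℕ) : Finset (Fin m) ≃ (Fin m → ZMod 2) where
  toFun s i := if i ∈ s then 1 else 0
  invFun μ := Finset.univ.filter fun i => μ i ≠ 0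
  left_inv s := by ext i; simp
  right_inv μ := by
    funext i
    have h : ∀ a : ZMod 2, (if a ≠ 0 then (1 : ZMod 2) else 0) = a := by decide
    simpa using h (μ i)

theorem hammingNorm_indicatorEquiv {m : ℕ} (s : Finset (Fin m)) :
    hammingNorm (indicatorEquiv m s) = s.card := by
  simp [hammingNorm, indicatorEquiv]

theorem eval_monomial_indicatorEquiv {m : ℕ} (s : Finset (Fin m)) (d : Fin m →₀ ℕ) (a : ZMod 2) :
    MvPolynomial.eval (indicatorEquiv m s) (MvPolynomial.monomial d a) =
      if d.support ⊆ s then a else 0 := by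
  rw [MvPolynomial.eval_monomial, Finsupp.prod]
  split_ifs with h
  · rw [Finset.prod_eq_one, mul_one]
    intro i hi
    simp [indicatorEquiv, h hi]
  · obtain ⟨i, hi, his⟩ := Finset.not_subset.mp h
    rw [Finset.prod_eq_zero hi, mul_zero]
    simpa [indicatorEquiv, his] using hi

theorem sum_powerset_eval_eq_zero {m : ℕ} (f : MvPolynomial (Fin m) (ZMod 2))
    (s : Finset (Fin m)) (hf : f.totalDegree < s.card) :
    ∑ t ∈ s.powerset, MvPolynomial.eval (indicatorEquiv m t) f = 0 := by
  have h (t : Finset (Fin m)) : MvPolynomial.eval (indicatorEquiv m t) f =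
      ∑ d ∈ f.support, if d.support ⊆ t then f.coeff d else 0 := by
    conv_lhs => rw [f.as_sum, map_sum]
    exact Finset.sum_congr rfl fun d _ => eval_monomial_indicatorEquiv t d _
  simp_rw [h]
  rw [Finset.sum_comm]
  refine Finset.sum_eq_zero fun d hd => ?_
  have hIcc : s.powerset.filter (fun t => d.support ⊆ t) = Finset.Icc d.support s := by
    ext t
    simp [and_comm]
  rw [← Finset.sum_filter, hIcc, Finset.sum_const, nsmul_eq_mul, natCast_card_Icc_finset,
    if_neg, zero_mul]
  rintro rfl
  have hcard : d.support.card ≤ d.sum fun _ e => e := by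
    rw [Finset.card_eq_sum_ones]
    exact Finset.sum_le_sum fun i hi => Nat.one_le_iff_ne_zero.mpr (Finsupp.mem_support_iff.mp hi)
  have := MvPolynomial.le_totalDegree hd
  omega

theorem eval_eq_zero_of_forall_hammingNorm_le {m v : ℕ} (f : MvPolynomial (Fin m) (ZMod 2))
    (hf : f.totalDegree ≤ v)
    (h : ∀ μ : Fin m → ZMod 2, hammingNorm μ ≤ v → MvPolynomial.eval μ f = 0)
    (μ : Fin m → ZMod 2) : MvPolynomial.eval μ f = 0 := by
  obtain ⟨s, rfl⟩ := (indicatorEquiv m).surjective μ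
  induction s using Finset.strongInduction with
  | H s ih =>
    by_cases hs : s.card ≤ v
    · exact h _ (by rwa [hammingNorm_indicatorEquiv])
    · rw [← sum_powerset_eval_eq_zero f s (by omega)]
      refine Eq.symm (Finset.sum_eq_single_of_mem s (Finset.mem_powerset_self s)
        fun t ht hts => ?_)
      exact ih t ((Finset.mem_powerset.mp ht).ssubset_of_ne hts)

/-- The square-free monomial with variables indexed by `s`, as a codeword. -/
noncomputable def monomialCodeword (v : ℕ) {m : ℕ} (s : Finset (Fin m)) (hs : s.card ≤ v) :
    RM v m :=
  ⟨evalLM m (MvPolynomial.monomial (Finsupp.indicator s fun _ _ => 1) 1), by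
    refine Submodule.mem_map_of_mem ?_
    rw [MvPolynomial.mem_restrictTotalDegree, MvPolynomial.totalDegree_monomial _ one_ne_zero]
    simpa using hs⟩

theorem monomialCodeword_apply {v m : ℕ} (s t : Finset (Fin m)) (hs : s.card ≤ v) :
    (monomialCodeword v s hs : (Fin m → ZMod 2) → ZMod 2) (indicatorEquiv m t) =
      if s ⊆ t then 1 else 0 := by
  have hsupp : (Finsupp.indicator s fun _ _ => 1 : Fin m →₀ ℕ).support = s := by
    ext i
    simp [Finsupp.indicator_apply]
  exact (eval_monomial_indicatorEquiv t _ 1).trans (by rw [hsupp])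

/-- The restriction of codewords to the points of weight at most `v`. -/
def restrictLowWeight (v m : ℕ) : RM v m →ₗ[ZMod 2] (lowWeightSet v m → ZMod 2) where
  toFun c i := (c : (Fin m → ZMod 2) → ZMod 2) i.1
  map_add' _ _ := rfl
  map_smul' _ _ := rfl

theorem restrictLowWeight_injective (v m : ℕ) : Function.Injective (restrictLowWeight v m) := by
  rw [injective_iff_map_eq_zero]
  rintro ⟨_, f, hf, rfl⟩ h
  ext μ
  refine eval_eq_zero_of_forall_hammingNorm_le f
    ((MvPolynomial.mem_restrictTotalDegree _ _ _).mp hf) (fun ν hν => ?_) μ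
  exact congrFun h ⟨ν, by simpa [lowWeightSet] using hν⟩

theorem exists_restrictLowWeight_eq_single {v m : ℕ} (μ : lowWeightSet v m) :
    ∃ c, restrictLowWeight v m c = Pi.single μ 1 := by
  obtain ⟨μ, hμ⟩ := μ
  obtain ⟨s, rfl⟩ := (indicatorEquiv m).surjective μ
  let S : Finset {t : Finset (Fin m) // t.card ≤ v} := Finset.univ.filter fun t => s ⊆ t.1
  refine ⟨∑ t ∈ S, monomialCodeword v t.1 t.2, ?_⟩
  funext ⟨ν, hν⟩
  obtain ⟨u, rfl⟩ := (indicatorEquiv m).surjective ν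
  have hu : u.card ≤ v := by simpa [lowWeightSet, hammingNorm_indicatorEquiv] using hν
  have hcard : (S.filter fun t => t.1 ⊆ u).card = (Finset.Icc s u).card := by
    refine Finset.card_bij (fun t _ => t.1) ?_ (fun _ _ _ _ h => Subtype.ext h) ?_
    · simp [S]
    · intro t ht
      rw [Finset.mem_Icc] at ht
      exact ⟨⟨t, (Finset.card_le_card ht.2).trans hu⟩, by simpa [S] using ht, rfl⟩
  rw [map_sum, Finset.sum_apply]
  trans ∑ t ∈ S, if t.1 ⊆ u then (1 : ZMod 2) else 0
  · exact Finset.sum_congr rfl fun t _ => monomialCodeword_apply t.1 u t.2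
  · rw [Finset.sum_boole, hcard, natCast_card_Icc_finset, Pi.single_apply]
    simp [eq_comm]

theorem restrictLowWeight_surjective (v m : ℕ) : Function.Surjective (restrictLowWeight v m) := by
  intro g
  choose c hc using exists_restrictLowWeight_eq_single (v := v) (m := m)
  refine ⟨∑ μ, g μ • c μ, ?_⟩
  simp_rw [map_sum, map_smul, hc]
  exact (pi_eq_sum_univ' g).symm

theorem card_lowWeightSet (v m : ℕ) :
    (lowWeightSet v m).card = ∑ i ∈ Finset.range (v + 1), m.choose i := by
  have hmap : lowWeightSet v m = (Finset.univ.filter fun s : Finset (Fin m) => s.card ≤ v).map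
      (indicatorEquiv m).toEmbedding := by
    ext μ
    obtain ⟨s, rfl⟩ := (indicatorEquiv m).surjective μ
    simp [lowWeightSet, hammingNorm_indicatorEquiv]
  rw [hmap, Finset.card_map, Finset.card_eq_sum_card_fiberwise (f := Finset.card)
    (t := Finset.range (v + 1)) (fun s hs => by simpa [Nat.lt_succ_iff] using hs)]
  refine Finset.sum_congr rfl fun i hi => ?_
  trans (Finset.powersetCard i (Finset.univ : Finset (Fin m))).card
  · congr 1
    ext s
    simp only [Finset.mem_filter, Finset.mem_univ, true_and, Finset.mem_powersetCard,
      Finset.subset_univ]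
    rw [Finset.mem_range] at hi
    omega
  · rw [Finset.card_powersetCard, Finset.card_fin]

/-- For `0 ≤ v ≤ m`, the restriction map `R(v,m) → (I → GF(2))`,
`f ↦ f|_I`, with `I = {μ : wt(μ) ≤ v}`, is a linear bijection; in particular `I` is an
information set of `R(v,m)` and `dim R(v,m) = |I| = Σ_{i=0}^v C(m,i)`.  Equivalently, a
polynomial over `GF(2)` of total degree at most `v` vanishing at every point of Hamming weight
at most `v` vanishes at every point of `GF(2)^m`. -/
theorem reed_muller_information_set (m v : ℕ) (hv : v ≤ m) :
    Function.Bijective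
        (fun (c : RM v m) (i : lowWeightSet v m) =>
          (c : (Fin m → ZMod 2) → ZMod 2) i.1) ∧
      IsInformationSet (RM v m) (lowWeightSet v m) ∧
      Module.finrank (ZMod 2) (RM v m) = (lowWeightSet v m).card ∧
      (lowWeightSet v m).card = ∑ i ∈ Finset.range (v + 1), m.choose i ∧
      ∀ f : MvPolynomial (Fin m) (ZMod 2), f.totalDegree ≤ v →
        (∀ μ : Fin m → ZMod 2, hammingNorm μ ≤ v → MvPolynomial.eval μ f = 0) →
        ∀ μ : Fin m → ZMod 2, MvPolynomial.eval μ f = 0 := by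
  have hinj := restrictLowWeight_injective v m
  have hsurj := restrictLowWeight_surjective v m
  have hrank : Module.finrank (ZMod 2) (RM v m) = (lowWeightSet v m).card := by
    rw [(LinearEquiv.ofBijective _ ⟨hinj, hsurj⟩).finrank_eq, Module.finrank_fintype_fun_eq_card,
      Fintype.card_coe]
  exact ⟨⟨hinj, hsurj⟩,
    ⟨hrank.symm, fun x y h => hinj (funext fun i => h i.1 i.2)⟩, hrank, card_lowWeightSet v m,
    eval_eq_zero_of_forall_hammingNorm_le⟩
end

section
/- For integers m ≥ 0 and 0 ≤ v ≤ m, set k = Σ_{i=0}^v binom(m,i). For every σ ∈ GF(2)^m, the translate I_σ = {σ + μ : μ ∈ GF(2)^m, wt(μ) ≤ v} is an information set of the Reed–Muller code R(v,m), and every point x ∈ GF(2)^m belongs to exactly k of the 2^m sets {I_σ : σ ∈ GF(2)^m}. In particular, R(v,m) is an MDS-PIR capacity-achieving code: an MDS-PIR capacity-achieving matrix Λ_{k,2^m}(R(v,m)) exists. -/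
open scoped Classical

/-- The translate `I_σ = {σ + μ : wt(μ) ≤ v}` of the low-weight information set. -/
def translateSet (v m : ℕ) (σ : Fin m → ZMod 2) : Finset (Fin m → ZMod 2) :=
  Finset.image (fun μ => σ + μ) (Finset.univ.filter fun μ => hammingNorm μ ≤ v)

/-- The squarefree monomial function `μ ↦ ∏ i ∈ S, μ i` on `GF(2)^m`. -/
def monomialFun {m : ℕ} (S : Finset (Fin m)) : (Fin m → ZMod 2) → ZMod 2 :=
  fun μ => ∏ i ∈ S, μ i

/-- The indicator vector of `S` in `GF(2)^m`. -/
def indicatorVec {m : ℕ} (S : Finset (Fin m)) : Fin m → ZMod 2 :=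
  fun i => if i ∈ S then 1 else 0

lemma hammingNorm_indicatorVec {m : ℕ} (S : Finset (Fin m)) :
    hammingNorm (indicatorVec S) = S.card := by
  simp [hammingNorm, indicatorVec]

lemma indicatorVec_filter_ne_zero {m : ℕ} (μ : Fin m → ZMod 2) :
    indicatorVec (Finset.univ.filter fun i => μ i ≠ 0) = μ := by
  funext i
  have h : ∀ a : ZMod 2, (if a ≠ 0 then (1 : ZMod 2) else 0) = a := by decide
  simpa [indicatorVec] using h (μ i)

lemma monomialFun_indicatorVec {m : ℕ} (T S : Finset (Fin m)) :
    monomialFun T (indicatorVec S) = if T ⊆ S then 1 else 0 := by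
  simp only [monomialFun, indicatorVec, Finset.prod_ite_zero, Finset.prod_const_one, Finset.subset_iff]

lemma card_filter_card_le (m v : ℕ) :
    (Finset.univ.filter fun S : Finset (Fin m) => S.card ≤ v).card =
      ∑ i ∈ Finset.range (v + 1), m.choose i := by
  rw [Finset.card_eq_sum_card_fiberwise (f := Finset.card) (t := Finset.range (v + 1))
    (fun S hS => by simpa [Nat.lt_succ_iff] using hS)]
  refine Finset.sum_congr rfl fun i hi => ?_
  have hi' : i ≤ v := Nat.lt_succ_iff.mp (Finset.mem_range.mp hi)
  have : (Finset.univ.filter fun S : Finset (Fin m) => S.card ≤ v).filter (fun S => S.card = i) =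
      Finset.powersetCard i Finset.univ := by
    ext S
    simp only [Finset.mem_filter, Finset.mem_univ, true_and, Finset.mem_powersetCard,
      Finset.subset_univ]
    omega
  rw [this, Finset.card_powersetCard, Finset.card_univ, Fintype.card_fin]

lemma card_filter_hammingNorm_le (m v : ℕ) :
    (Finset.univ.filter fun μ : Fin m → ZMod 2 => hammingNorm μ ≤ v).card =
      ∑ i ∈ Finset.range (v + 1), m.choose i := by
  rw [← card_filter_card_le]
  refine Finset.card_bij' (fun μ _ => Finset.univ.filter fun i => μ i ≠ 0)
    (fun S _ => indicatorVec S) ?_ ?_ ?_ ?_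
  · intro μ hμ
    simpa [hammingNorm] using hμ
  · intro S hS
    simpa [hammingNorm_indicatorVec] using hS
  · intro μ _
    exact indicatorVec_filter_ne_zero μ
  · intro S _
    ext i
    simp [indicatorVec]

lemma mem_translateSet {v m : ℕ} {σ x : Fin m → ZMod 2} :
    x ∈ translateSet v m σ ↔ hammingNorm (x - σ) ≤ v := by
  simp only [translateSet, Finset.mem_image, Finset.mem_filter, Finset.mem_univ, true_and]
  constructor
  · rintro ⟨μ, hμ, rfl⟩
    simpa using hμ
  · intro h
    exact ⟨x - σ, h, by simp⟩

lemma card_translateSet (v m : ℕ) (σ : Fin m → ZMod 2) :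
    (translateSet v m σ).card = ∑ i ∈ Finset.range (v + 1), m.choose i := by
  rw [translateSet, Finset.card_image_of_injective _ (add_right_injective σ),
    card_filter_hammingNorm_le]

lemma card_filter_mem_translateSet (v m : ℕ) (x : Fin m → ZMod 2) :
    (Finset.univ.filter fun σ : Fin m → ZMod 2 => x ∈ translateSet v m σ).card =
      ∑ i ∈ Finset.range (v + 1), m.choose i := by
  rw [← card_filter_hammingNorm_le]
  refine Finset.card_bij' (fun σ _ => x - σ) (fun μ _ => x - μ) ?_ ?_ ?_ ?_
  · intro σ hσ
    simpa [mem_translateSet] using hσ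
  · intro μ hμ
    simpa [mem_translateSet] using hμ
  · intro σ _
    simp
  · intro μ _
    simp

/-- A combination of squarefree monomials of degree at most `v` that vanishes at all points of
weight at most `v` has all coefficients zero. -/
lemma coeff_eq_zero_of_vanish {m v : ℕ} (c : {S : Finset (Fin m) // S.card ≤ v} → ZMod 2)
    (h : ∀ μ, hammingNorm μ ≤ v → ∑ T, c T * monomialFun T.1 μ = 0) : c = 0 := by
  suffices H : ∀ S : Finset (Fin m), ∀ hS : S.card ≤ v, c ⟨S, hS⟩ = 0 from
    funext fun S => H S.1 S.2
  intro S
  induction S using Finset.strongInduction with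
  | H S ih =>
    intro hS
    have := h (indicatorVec S) (by rwa [hammingNorm_indicatorVec])
    rw [Finset.sum_eq_single ⟨S, hS⟩] at this
    · simpa [monomialFun_indicatorVec] using this
    · rintro ⟨T, hT⟩ _ hne
      rw [monomialFun_indicatorVec]
      split_ifs with hTS
      · rw [ih T (hTS.ssubset_of_ne fun h => hne (Subtype.ext h)) hT, zero_mul]
      · exact mul_zero _
    · simp

lemma evalLM_monomial {m : ℕ} (d : Fin m →₀ ℕ) (a : ZMod 2) :
    evalLM m (MvPolynomial.monomial d a) = a • monomialFun d.support := by
  funext μ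
  have h : ∀ (b : ZMod 2) (n : ℕ), n ≠ 0 → b ^ n = b := by
    intro b n hn
    have hb : ∀ b : ZMod 2, b = 0 ∨ b = 1 := by decide
    rcases hb b with rfl | rfl <;> simp [hn]
  simp only [evalLM, LinearMap.coe_mk, AddHom.coe_mk, MvPolynomial.eval_monomial, Finsupp.prod,
    Pi.smul_apply, smul_eq_mul, monomialFun]
  congr 1
  exact Finset.prod_congr rfl fun i hi => h _ _ (Finsupp.mem_support_iff.mp hi)

lemma monomialFun_mem_RM {m v : ℕ} {S : Finset (Fin m)} (hS : S.card ≤ v) :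
    monomialFun S ∈ RM v m := by
  refine ⟨∏ i ∈ S, MvPolynomial.X i, ?_, ?_⟩
  · rw [SetLike.mem_coe, MvPolynomial.mem_restrictTotalDegree]
    refine (MvPolynomial.totalDegree_finsetProd _ _).trans ?_
    simpa using hS
  · funext μ
    simp [evalLM, monomialFun]

lemma RM_eq_span (v m : ℕ) :
    RM v m = Submodule.span (ZMod 2)
      (Set.range fun S : {S : Finset (Fin m) // S.card ≤ v} => monomialFun S.1) := by
  apply le_antisymm
  · rintro _ ⟨p, hp, rfl⟩
    rw [SetLike.mem_coe, MvPolynomial.mem_restrictTotalDegree] at hp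
    rw [p.as_sum, map_sum]
    refine Submodule.sum_mem _ fun d hd => ?_
    rw [evalLM_monomial]
    refine Submodule.smul_mem _ _ (Submodule.subset_span ⟨⟨d.support, ?_⟩, rfl⟩)
    refine le_trans ?_ ((MvPolynomial.le_totalDegree hd).trans hp)
    rw [Finset.card_eq_sum_ones]
    exact Finset.sum_le_sum fun i hi =>
      Nat.one_le_iff_ne_zero.mpr (Finsupp.mem_support_iff.mp hi)
  · rw [Submodule.span_le]
    rintro _ ⟨S, rfl⟩
    exact monomialFun_mem_RM S.2

lemma linearIndependent_monomialFun (v m : ℕ) :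
    LinearIndependent (ZMod 2)
      (fun S : {S : Finset (Fin m) // S.card ≤ v} => monomialFun S.1) := by
  rw [Fintype.linearIndependent_iff]
  intro c hc
  refine congrFun (coeff_eq_zero_of_vanish c fun μ _ => ?_)
  simpa using congrFun hc μ

lemma finrank_RM (v m : ℕ) :
    Module.finrank (ZMod 2) (RM v m) = ∑ i ∈ Finset.range (v + 1), m.choose i := by
  rw [RM_eq_span, finrank_span_eq_card (linearIndependent_monomialFun v m),
    ← card_filter_card_le, Fintype.card_subtype]

/-- A codeword of `R(v,m)` vanishing at all points of weight at most `v` is zero. -/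
lemma RM_eq_zero_of_vanish {v m : ℕ} {f : (Fin m → ZMod 2) → ZMod 2} (hf : f ∈ RM v m)
    (h : ∀ μ, hammingNorm μ ≤ v → f μ = 0) : f = 0 := by
  rw [RM_eq_span, Submodule.mem_span_range_iff_exists_fun] at hf
  obtain ⟨c, rfl⟩ := hf
  rw [coeff_eq_zero_of_vanish c fun μ hμ => by simpa using h μ hμ]
  simp

lemma RM_translate {v m : ℕ} (σ : Fin m → ZMod 2) {f : (Fin m → ZMod 2) → ZMod 2}
    (hf : f ∈ RM v m) : (fun μ => f (σ + μ)) ∈ RM v m := by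
  suffices H : RM v m ≤ (RM v m).comap (LinearMap.funLeft (ZMod 2) (ZMod 2) (σ + ·)) from H hf
  conv_lhs => rw [RM_eq_span]
  rw [Submodule.span_le]
  rintro _ ⟨S, rfl⟩
  have hS : LinearMap.funLeft (ZMod 2) (ZMod 2) (σ + ·) (monomialFun S.1) =
      ∑ T ∈ S.1.powerset, (∏ i ∈ T, σ i) • monomialFun (S.1 \ T) := by
    funext μ
    simp [LinearMap.funLeft_apply, monomialFun, Finset.prod_add]
  rw [SetLike.mem_coe, Submodule.mem_comap, hS]
  exact Submodule.sum_mem _ fun T _ => Submodule.smul_mem _ _ <|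
    monomialFun_mem_RM ((Finset.card_le_card Finset.sdiff_subset).trans S.2)

lemma isInformationSet_translateSet (v m : ℕ) (σ : Fin m → ZMod 2) :
    IsInformationSet (RM v m) (translateSet v m σ) := by
  refine ⟨by rw [card_translateSet, finrank_RM], fun x y h => Subtype.ext ?_⟩
  have hz := RM_eq_zero_of_vanish (RM_translate σ (x - y).2) fun μ hμ => by
    have := h (σ + μ) (mem_translateSet.mpr (by simpa using hμ))
    simp [this]
  funext μ
  have := congrFun hz (μ - σ)
  simpa [sub_eq_zero] using this

/-- For `0 ≤ v ≤ m` and `k = Σ_{i=0}^v C(m,i)`, every translate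
`I_σ = {σ+μ : wt(μ) ≤ v}` is an information set of the Reed–Muller code `R(v,m)`, and every
point of `GF(2)^m` belongs to exactly `k` of the `2^m` sets `I_σ`.  In particular `R(v,m)` is
MDS-PIR capacity-achieving: an MDS-PIR capacity-achieving matrix `Λ_{k,2^m}(R(v,m))` exists. -/
theorem reed_muller_mds_pir_capacity_achieving (m v : ℕ) (hv : v ≤ m) :
    (∀ σ : Fin m → ZMod 2, IsInformationSet (RM v m) (translateSet v m σ)) ∧
      (∀ x : Fin m → ZMod 2,
        (Finset.univ.filter fun σ : Fin m → ZMod 2 => x ∈ translateSet v m σ).card =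
          ∑ i ∈ Finset.range (v + 1), m.choose i) ∧
      ∃ Λ : (Fin m → ZMod 2) → (Fin m → ZMod 2) → Bool,
        IsMDSPIRCapacityAchievingMatrix (RM v m)
          (∑ i ∈ Finset.range (v + 1), m.choose i) Λ := by
  have hcol := card_filter_mem_translateSet v m
  refine ⟨isInformationSet_translateSet v m, hcol,
    fun σ x => decide (x ∈ translateSet v m σ), ⟨fun x => ?_, fun σ => ?_⟩, ?_⟩
  · simpa using hcol x
  · exact ⟨translateSet v m σ, isInformationSet_translateSet v m σ, fun j hj => by simpa using hj⟩
  · rw [finrank_RM]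
end

section
/- Under the distance-optimal (r,δ) information locality code setup (see context), the code C = {x ∈ F^n : Hx = 0} has dimension k = L_c·r, and there exist n information sets I_1,…,I_n of C such that every coordinate j ∈ {1,…,n} belongs to exactly k of them; i.e., an MDS-PIR capacity-achieving matrix Λ_{k,n}(C) exists and C is an MDS-PIR capacity-achieving code. -/
open scoped Classical

/-- The parity-check matrix `H` of the `(r,δ)` information locality code: block-diagonal local
parts `(P_j | I_{δ−1})` on the local coordinate sets `S_j = {(j−1)n_c+1,…,j·n_c}`
(`n_c = r+δ−1`), followed by global rows `(M_j | 0)` on each `S_j` together with `I_a` on the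
last `a` (global parity) coordinates.  The matrices `P_j, M_j` are encoded as functions
`P M : ℕ → ℕ → ℕ → F` (block index, row, column). -/
def lrcH (F : Type*) [Field F] (r δ Lc a : ℕ) (P M : ℕ → ℕ → ℕ → F) :
    Matrix (Fin (Lc * (δ - 1) + a)) (Fin (Lc * (r + δ - 1) + a)) F := fun i x =>
  if i.val < Lc * (δ - 1) then
    -- local rows: row `i.val % (δ-1)` of the local code `i.val / (δ-1)`
    if x.val < Lc * (r + δ - 1) then
      if i.val / (δ - 1) = x.val / (r + δ - 1) then
        if x.val % (r + δ - 1) < r then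
          P (x.val / (r + δ - 1)) (i.val % (δ - 1)) (x.val % (r + δ - 1))
        else if x.val % (r + δ - 1) = r + i.val % (δ - 1) then 1 else 0
      else 0
    else 0
  else
    -- global rows
    if x.val < Lc * (r + δ - 1) then
      if x.val % (r + δ - 1) < r then
        M (x.val / (r + δ - 1)) (i.val - Lc * (δ - 1)) (x.val % (r + δ - 1))
      else 0
    else if x.val = Lc * (r + δ - 1) + (i.val - Lc * (δ - 1)) then 1 else 0

/-- The matrix `H^MDS`: the horizontal concatenation, for `j = 1,…,L_c`, of the
`(δ−1+a)×r` blocks obtained by stacking `P_j` on top of `M_j`, followed by `I_{δ−1+a}`. -/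
def lrcHMDS (F : Type*) [Field F] (r δ Lc a : ℕ) (P M : ℕ → ℕ → ℕ → F) :
    Matrix (Fin ((δ - 1) + a)) (Fin (Lc * r + (δ - 1) + a)) F := fun i x =>
  if x.val < Lc * r then
    if i.val < δ - 1 then P (x.val / r) i.val (x.val % r)
    else M (x.val / r) (i.val - (δ - 1)) (x.val % r)
  else if x.val = Lc * r + i.val then 1 else 0

/-- The local parity-check matrix `(P_j | I_{δ−1})` of the `j`-th local code. -/
def lrcLocal (F : Type*) [Field F] (r δ : ℕ) (Pj : ℕ → ℕ → F) :
    Matrix (Fin (δ - 1)) (Fin (r + δ - 1)) F := fun i x =>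
  if x.val < r then Pj i.val x.val
  else if x.val = r + i.val then 1 else 0

/-- Rado's theorem for a monotone submodular function. -/
theorem exists_transversal_of_submodular {ι κ : Type*} [Fintype ι] [DecidableEq ι] [DecidableEq κ]
    (f : Finset κ → ℕ) (hmono : ∀ S T, S ⊆ T → f S ≤ f T)
    (hsub : ∀ S T, f (S ∪ T) + f (S ∩ T) ≤ f S + f T) (hempty : f ∅ = 0)
    (A : ι → Finset κ) (hA : ∀ J : Finset ι, J.card ≤ f (J.biUnion A)) :
    ∃ g : ι → κ, (∀ t, g t ∈ A t) ∧ ∀ J : Finset ι, J.card ≤ f (J.image g) := by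
  induction hN : ∑ t, (A t).card using Nat.strong_induction_on generalizing A with
  | _ N ih =>
  have hne : ∀ t, (A t).Nonempty := by
    intro t
    rw [Finset.nonempty_iff_ne_empty]
    intro h
    have := hA {t}
    simp [h, hempty] at this
  by_cases h : ∃ t, 1 < (A t).card
  · obtain ⟨t, ht⟩ := h
    obtain ⟨x, hx, y, hy, hxy⟩ := Finset.one_lt_card.1 ht
    have key : (∀ J : Finset ι, J.card ≤ f (J.biUnion (Function.update A t ((A t).erase x)))) ∨
        (∀ J : Finset ι, J.card ≤ f (J.biUnion (Function.update A t ((A t).erase y)))) := by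
      by_contra hcon
      push Not at hcon
      obtain ⟨⟨J, hJ⟩, ⟨K, hK⟩⟩ := hcon
      have hmem : ∀ (J : Finset ι) (z : κ),
          f (J.biUnion (Function.update A t ((A t).erase z))) < J.card → t ∈ J := by
        intro J z hJ
        by_contra htJ
        have : J.biUnion (Function.update A t ((A t).erase z)) = J.biUnion A := by
          refine Finset.biUnion_congr rfl fun s hs => ?_
          rw [Function.update_of_ne]
          rintro rfl
          exact htJ hs
        rw [this] at hJ
        exact absurd (hA J) (by omega)
      have htJ := hmem J x hJ
      have htK := hmem K y hK
      have h1 : (J ∪ K).card ≤ f (J.biUnion (Function.update A t ((A t).erase x)) ∪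
          K.biUnion (Function.update A t ((A t).erase y))) := by
        refine (hA _).trans (hmono _ _ fun z hz => ?_)
        simp only [Finset.mem_biUnion, Finset.mem_union] at hz ⊢
        obtain ⟨s, hs, hz⟩ := hz
        by_cases hst : s = t
        · subst hst
          by_cases hzx : z = x
          · exact Or.inr ⟨s, htK, by simp [hzx, hxy, hx]⟩
          · exact Or.inl ⟨s, htJ, by simp [hz, hzx]⟩
        · rcases hs with hs | hs
          · exact Or.inl ⟨s, hs, by simpa [hst] using hz⟩
          · exact Or.inr ⟨s, hs, by simpa [hst] using hz⟩
      have h2 : ((J ∩ K).erase t).card ≤ f (J.biUnion (Function.update A t ((A t).erase x)) ∩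
          K.biUnion (Function.update A t ((A t).erase y))) := by
        refine (hA _).trans (hmono _ _ fun z hz => ?_)
        simp only [Finset.mem_biUnion, Finset.mem_inter, Finset.mem_erase] at hz ⊢
        obtain ⟨s, ⟨hst, hsJ, hsK⟩, hz⟩ := hz
        exact ⟨⟨s, hsJ, by simpa [hst] using hz⟩, ⟨s, hsK, by simpa [hst] using hz⟩⟩
      rw [Finset.card_erase_of_mem (Finset.mem_inter.2 ⟨htJ, htK⟩)] at h2
      have h3 := hsub (J.biUnion (Function.update A t ((A t).erase x)))
        (K.biUnion (Function.update A t ((A t).erase y)))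
      have h4 := Finset.card_union_add_card_inter J K
      omega
    have step : ∀ z ∈ A t,
        (∀ J : Finset ι, J.card ≤ f (J.biUnion (Function.update A t ((A t).erase z)))) →
        ∃ g : ι → κ, (∀ t, g t ∈ A t) ∧ ∀ J : Finset ι, J.card ≤ f (J.image g) := by
      intro z hz hJ
      have hle : ∀ s, Function.update A t ((A t).erase z) s ⊆ A s := by
        intro s
        by_cases hst : s = t
        · subst hst
          simpa using Finset.erase_subset z _
        · simp [hst]
      obtain ⟨g, hg, hg'⟩ := ih (∑ s, (Function.update A t ((A t).erase z) s).card)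
        (by
          rw [← hN]
          refine Finset.sum_lt_sum (fun s _ => Finset.card_le_card (hle s))
            ⟨t, Finset.mem_univ t, ?_⟩
          simpa using Finset.card_erase_lt_of_mem hz) _ hJ rfl
      exact ⟨g, fun s => hle s (hg s), hg'⟩
    rcases key with h | h
    · exact step x hx h
    · exact step y hy h
  · push Not at h
    choose g hg using hne
    refine ⟨g, hg, fun J => (hA J).trans (hmono _ _ fun z hz => ?_)⟩
    obtain ⟨s, hs, hz⟩ := Finset.mem_biUnion.1 hz
    rw [Finset.card_le_one.1 (h s) z hz (g s) (hg s)]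
    exact Finset.mem_image_of_mem g hs

/-- A uniformly dense matroid of rank at most `k` on `n` elements has `n` bases of size `k` that
cover every element exactly `k` times. -/
theorem exists_balanced_family_of_density {X : Type*} [Fintype X] [DecidableEq X] (k : ℕ)
    (ρ : Finset X → ℕ) (hmono : ∀ S T, S ⊆ T → ρ S ≤ ρ T)
    (hsub : ∀ S T, ρ (S ∪ T) + ρ (S ∩ T) ≤ ρ S + ρ T) (hcard : ∀ S, ρ S ≤ S.card)
    (hk : ∀ S, ρ S ≤ k) {n : ℕ} (hn : Fintype.card X = n)
    (hdense : ∀ S, k * S.card ≤ n * ρ S) :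
    ∃ I : Fin n → Finset X, (∀ i, (I i).card = k ∧ ρ (I i) = k) ∧
      ∀ x, (Finset.univ.filter fun i => x ∈ I i).card = k := by
  let slice : Finset (X × Fin n) → Fin n → Finset X :=
    fun S i => Finset.univ.filter fun x => (x, i) ∈ S
  have hslice : ∀ S, ∑ i, (slice S i).card = S.card := by
    intro S
    rw [Finset.card_eq_sum_card_fiberwise (f := Prod.snd) (t := Finset.univ)
      (fun _ _ => Finset.mem_coe.2 (Finset.mem_univ _))]
    refine Finset.sum_congr rfl fun i _ => ?_
    refine Finset.card_bij (fun x _ => (x, i)) ?_ ?_ ?_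
    · intro x hx
      simpa [slice] using hx
    · intro x _ y _ h
      exact (Prod.ext_iff.1 h).1
    · rintro ⟨x, j⟩ h
      simp only [Finset.mem_filter] at h
      obtain ⟨h, rfl⟩ := h
      exact ⟨x, by simpa [slice] using h, rfl⟩
  let f : Finset (X × Fin n) → ℕ := fun S => ∑ i, ρ (slice S i)
  have hfcard : ∀ S, f S ≤ S.card := fun S =>
    (hslice S).symm ▸ Finset.sum_le_sum fun i _ => hcard _
  obtain ⟨g, hgA, hg⟩ := exists_transversal_of_submodular (ι := X × Fin k) f
    (fun S T hST => Finset.sum_le_sum fun i _ => hmono _ _ fun x hx => by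
      simp only [slice, Finset.mem_filter] at hx ⊢
      exact ⟨hx.1, hST hx.2⟩)
    (fun S T => by
      simp only [f]
      rw [← Finset.sum_add_distrib, ← Finset.sum_add_distrib]
      refine Finset.sum_le_sum fun i _ => ?_
      have h1 : slice (S ∪ T) i = slice S i ∪ slice T i := by
        ext x; simp [slice]
      have h2 : slice (S ∩ T) i = slice S i ∩ slice T i := by
        ext x; simp [slice]
      rw [h1, h2]
      exact hsub _ _)
    (Nat.le_zero.1 (hfcard ∅))
    (fun p => {p.1} ×ˢ Finset.univ)
    (fun J => by
      have h1 : ∀ i, slice (J.biUnion fun p => {p.1} ×ˢ Finset.univ) i = J.image Prod.fst := by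
        intro i
        ext x
        simp [slice]
      simp only [f, h1, Finset.sum_const, Finset.card_univ, Fintype.card_fin, smul_eq_mul]
      refine le_trans ?_ (hdense _)
      have h2 : J ⊆ J.image Prod.fst ×ˢ Finset.univ := fun p hp =>
        Finset.mem_product.2 ⟨Finset.mem_image_of_mem _ hp, Finset.mem_univ _⟩
      calc J.card ≤ _ := Finset.card_le_card h2
        _ = k * (J.image Prod.fst).card := by
          rw [Finset.card_product, Finset.card_univ, Fintype.card_fin, mul_comm])
  have hfst : ∀ p, (g p).1 = p.1 := fun p =>
    Finset.mem_singleton.1 (Finset.mem_product.1 (hgA p)).1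
  have hinj : Function.Injective g := by
    intro p q hpq
    exact Finset.card_image_iff.1 (le_antisymm Finset.card_image_le
      ((hg Finset.univ).trans (hfcard _))) (by simp) (by simp) hpq
  set S := Finset.univ.image g with hS
  have hScard : S.card = n * k := by
    rw [hS, Finset.card_image_of_injective _ hinj, Finset.card_univ, Fintype.card_prod, hn,
      Fintype.card_fin]
  have hρ : ∀ i, ρ (slice S i) = (slice S i).card := by
    have hle : ∑ i, (slice S i).card ≤ ∑ i, ρ (slice S i) := by
      rw [hslice, hS, Finset.card_image_of_injective _ hinj]
      exact hg Finset.univ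
    have heq := le_antisymm (Finset.sum_le_sum fun i _ => hcard (slice S i)) hle
    exact fun i => (Finset.sum_eq_sum_iff_of_le fun i _ => hcard (slice S i)).1 heq i
      (Finset.mem_univ i)
  have hsize : ∀ i, (slice S i).card = k := by
    have heq : ∑ i, (slice S i).card = ∑ _i : Fin n, k := by
      rw [hslice, hScard]
      simp
    exact fun i => (Finset.sum_eq_sum_iff_of_le fun i _ => hρ i ▸ hk (slice S i)).1 heq i
      (Finset.mem_univ i)
  refine ⟨slice S, fun i => ⟨hsize i, (hρ i).trans (hsize i)⟩, fun x => ?_⟩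
  have hcov : (Finset.univ.filter fun i => x ∈ slice S i) =
      Finset.univ.image fun l : Fin k => (g (x, l)).2 := by
    ext i
    simp only [slice, hS, Finset.mem_filter, Finset.mem_univ, true_and, Finset.mem_image,
      Prod.exists]
    constructor
    · rintro ⟨y, l, h⟩
      have hy : x = y := (congrArg Prod.fst h).symm.trans (hfst (y, l))
      subst hy
      exact ⟨l, by rw [h]⟩
    · rintro ⟨l, rfl⟩
      exact ⟨x, l, Prod.ext (hfst _) rfl⟩
  rw [hcov, Finset.card_image_of_injective, Finset.card_univ, Fintype.card_fin]
  intro l l' h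
  have heq : g (x, l) = g (x, l') := Prod.ext ((hfst (x, l)).trans (hfst (x, l')).symm) h
  exact (Prod.ext_iff.1 (hinj heq)).2

/-- A code all of whose shortenings `D` satisfy `dim C * |A| + n * dim D ≤ n * dim C`, where `D`
vanishes on `A`, has `n` information sets covering every coordinate exactly `dim C` times. -/
theorem exists_balanced_informationSets {X F : Type*} [Fintype X] [DecidableEq X] [Field F]
    (C : Submodule F (X → F)) {n : ℕ} (hn : Fintype.card X = n)
    (hC : ∀ D ≤ C, ∀ A : Finset X, (∀ c ∈ D, ∀ x ∈ A, c x = 0) →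
      Module.finrank F C * A.card + n * Module.finrank F D ≤ n * Module.finrank F C) :
    ∃ I : Fin n → Finset X, (∀ i, IsInformationSet C (I i)) ∧
      ∀ x, (Finset.univ.filter fun i => x ∈ I i).card = Module.finrank F C := by
  let φ : X → Module.Dual F C := fun x => (LinearMap.proj x).comp C.subtype
  let V : Finset X → Submodule F (Module.Dual F C) := fun A => Submodule.span F (φ '' A)
  have hann : ∀ A, Module.finrank F (V A) + Module.finrank F (V A).dualCoannihilator =
      Module.finrank F C := fun A => Subspace.finrank_add_finrank_dualCoannihilator_eq (V A)
  have hmono : ∀ S T : Finset X, S ⊆ T → V S ≤ V T := fun S T h =>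
    Submodule.span_mono (Set.image_mono (Finset.coe_subset.2 h))
  obtain ⟨I, hI, hcov⟩ := exists_balanced_family_of_density (Module.finrank F C)
    (fun A => Module.finrank F (V A))
    (fun S T h => Submodule.finrank_mono (hmono S T h))
    (fun S T => by
      have h1 : V (S ∪ T) = V S ⊔ V T := by
        simp only [V]
        rw [Finset.coe_union, Set.image_union, Submodule.span_union]
      have h2 : V (S ∩ T) ≤ V S ⊓ V T :=
        le_inf (hmono _ _ Finset.inter_subset_left) (hmono _ _ Finset.inter_subset_right)
      rw [← Submodule.finrank_sup_add_finrank_inf_eq (V S) (V T), h1]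
      exact Nat.add_le_add_left (Submodule.finrank_mono h2) _)
    (fun S => by
      have := (finrank_span_finset_le_card (R := F) (S.image φ)).trans Finset.card_image_le
      rwa [Finset.coe_image] at this)
    (fun S => le_of_le_of_eq (Nat.le_add_right _ _) (hann S)) hn
    (fun S => by
      have h := hC ((V S).dualCoannihilator.map C.subtype) (Submodule.map_subtype_le _ _) S (by
        rintro _ ⟨c, hc, rfl⟩ x hx
        exact (Submodule.mem_dualCoannihilator _).1 hc (φ x)
          (Submodule.subset_span (Set.mem_image_of_mem φ hx)))
      rw [Submodule.finrank_map_subtype_eq] at h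
      have := hann S
      nlinarith)
  refine ⟨I, fun i => ⟨(hI i).1, fun x y hxy => ?_⟩, hcov⟩
  have hbot : (V (I i)).dualCoannihilator = ⊥ := by
    have := hann (I i)
    have := (hI i).2
    exact Submodule.finrank_eq_zero.1 (by omega)
  rw [← sub_eq_zero, ← Submodule.mem_bot F, ← hbot, Submodule.mem_dualCoannihilator]
  intro ψ hψ
  induction hψ using Submodule.span_induction with
  | mem ψ h =>
    obtain ⟨z, hz, rfl⟩ := h
    simpa [φ, sub_eq_zero] using hxy z hz
  | zero => rfl
  | add ψ₁ ψ₂ _ _ h₁ h₂ => rw [LinearMap.add_apply, h₁, h₂, add_zero]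
  | smul c ψ _ h => rw [LinearMap.smul_apply, h, smul_zero]

/-- If every `m` of the parity-check columns `h y` are linearly independent, then a code word of
weight at most `m` is zero. -/
theorem eq_zero_of_card_support_le {F Y : Type*} [Field F] [Fintype Y] {m : ℕ}
    {h : Y → Fin m → F}
    (hind : ∀ E : Finset Y, E.card = m → LinearIndependent F (fun e : E => h e))
    (hm : m ≤ Fintype.card Y) {c : Y → F} (hc : ∑ y, c y • h y = 0) {E : Finset Y}
    (hE : ∀ y ∉ E, c y = 0) (hcard : E.card ≤ m) : c = 0 := by
  obtain ⟨E', hEE', hE'⟩ := Finset.exists_superset_card_eq hcard hm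
  have hout : ∀ y ∉ E', c y = 0 := fun y hy => hE y fun h => hy (hEE' h)
  have hsum : ∑ e : E', c e • h e = 0 := by
    rw [Finset.sum_coe_sort E' fun y => c y • h y, ← hc]
    exact Finset.sum_subset (Finset.subset_univ _) fun y _ hy => by rw [hout y hy, zero_smul]
  have hzero := Fintype.linearIndependent_iff.1 (hind E' hE') (fun e => c e) hsum
  funext y
  by_cases hy : y ∈ E'
  · exact hzero ⟨y, hy⟩
  · exact hout y hy

/-- Generalized Singleton bound attained by MDS codes: a nonzero subcode `W` has support of size
at least `m + dim W`, where `m` is the redundancy. -/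
theorem add_finrank_le_card_support {F Y : Type*} [Field F] [Fintype Y] {m : ℕ}
    {h : Y → Fin m → F}
    (hind : ∀ E : Finset Y, E.card = m → LinearIndependent F (fun e : E => h e))
    (hm : m ≤ Fintype.card Y) {W : Submodule F (Y → F)} (hW : ∀ c ∈ W, ∑ y, c y • h y = 0)
    (hne : W ≠ ⊥) {E : Finset Y} (hE : ∀ c ∈ W, ∀ y ∉ E, c y = 0) :
    m + Module.finrank F W ≤ E.card := by
  rcases le_or_gt E.card m with hcard | hcard
  · exact absurd ((Submodule.eq_bot_iff W).2 fun c hc =>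
      eq_zero_of_card_support_le hind hm (hW c hc) (hE c hc) hcard) hne
  · obtain ⟨E', hE'E, hE'⟩ := Finset.exists_subset_card_eq hcard.le
    let res : W →ₗ[F] ((E \ E' : Finset Y) → F) :=
      (LinearMap.funLeft F F (fun y : (E \ E' : Finset Y) => (y : Y))).comp W.subtype
    have hinj : Function.Injective res := by
      rw [← LinearMap.ker_eq_bot, LinearMap.ker_eq_bot']
      rintro ⟨c, hc⟩ h0
      refine Subtype.ext (eq_zero_of_card_support_le hind hm (hW c hc) (E := E') ?_ hE'.le)
      intro y hy
      by_cases hyE : y ∈ E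
      · exact congrFun h0 ⟨y, Finset.mem_sdiff.2 ⟨hyE, hy⟩⟩
      · exact hE c hc y hyE
    have := LinearMap.finrank_le_finrank_of_injective hinj
    rw [Module.finrank_fintype_fun_eq_card, Fintype.card_coe, Finset.card_sdiff_of_subset hE'E,
      hE'] at this
    omega

/-- The `y`-th coordinate of the `j`-th local group. -/
def localCoord {L m a : ℕ} (j : Fin L) (y : Fin m) : Fin (L * m + a) :=
  ⟨j * m + y, by
    have h : (j + 1) * m ≤ L * m := Nat.mul_le_mul_right m j.2
    rw [Nat.succ_mul] at h
    omega⟩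

theorem localCoord_injective {L m a : ℕ} (j : Fin L) :
    Function.Injective (localCoord (a := a) (m := m) j) := by
  intro y z h
  have := congrArg Fin.val h
  simp only [localCoord] at this
  exact Fin.ext (by omega)

/-- Merging coordinates along `τ` maps `D` into an MDS code of redundancy `m`; if `D` is determined
by the coordinates that are not merged, then the support of `D` has size at least `m + dim D`. -/
theorem add_finrank_le_card_support_of_merge {F X Y : Type*} [Field F] [Fintype X] [Fintype Y]
    {m : ℕ} {h : Y → Fin m → F}
    (hind : ∀ E : Finset Y, E.card = m → LinearIndependent F (fun e : E => h e))
    (hm : m ≤ Fintype.card Y) (τ : X → Y) {D : Submodule F (X → F)}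
    (hD : ∀ c ∈ D, ∑ x, c x • h (τ x) = 0)
    (hinj : ∀ c ∈ D, (∀ x, (∀ x', τ x' = τ x → x' = x) → c x = 0) → c = 0)
    (hne : D ≠ ⊥) {E : Finset X} (hE : ∀ c ∈ D, ∀ x ∉ E, c x = 0) :
    m + Module.finrank F D ≤ E.card := by
  let T : (X → F) →ₗ[F] (Y → F) :=
    LinearMap.pi fun y => ∑ x ∈ Finset.univ.filter fun x => τ x = y, LinearMap.proj x
  have hT : ∀ c y, T c y = ∑ x ∈ Finset.univ.filter fun x => τ x = y, c x := by
    intro c y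
    simp [T]
  have hTinj : Function.Injective (T.domRestrict D) := by
    rw [← LinearMap.ker_eq_bot, LinearMap.ker_eq_bot']
    rintro ⟨c, hc⟩ h0
    refine Subtype.ext (hinj c hc fun x hx => ?_)
    have hfib : (Finset.univ.filter fun x' => τ x' = τ x) = {x} := by
      ext x'
      simp only [Finset.mem_filter, Finset.mem_univ, true_and, Finset.mem_singleton]
      exact ⟨hx x', fun h => h ▸ rfl⟩
    have h1 : T c (τ x) = 0 := congrFun h0 (τ x)
    rwa [hT, hfib, Finset.sum_singleton] at h1
  have hfin : Module.finrank F (D.map T) = Module.finrank F D := by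
    rw [← LinearMap.range_domRestrict, LinearMap.finrank_range_of_inj hTinj]
  rw [← hfin]
  refine (add_finrank_le_card_support hind hm (W := D.map T) (E := E.image τ) ?_ ?_ ?_).trans
    Finset.card_image_le
  · rintro _ ⟨c, hc, rfl⟩
    rw [← hD c hc, ← Finset.sum_fiberwise Finset.univ τ]
    refine Finset.sum_congr rfl fun y _ => ?_
    rw [hT, Finset.sum_smul]
    refine Finset.sum_congr rfl fun x hx => ?_
    rw [(Finset.mem_filter.1 hx).2]
  · intro hbot
    rw [hbot, finrank_bot] at hfin
    exact hne (Submodule.finrank_eq_zero.1 hfin.symm)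
  · rintro _ ⟨c, hc, rfl⟩ y hy
    rw [hT]
    refine Finset.sum_eq_zero fun x hx => hE c hc x fun hxE => hy ?_
    exact Finset.mem_image.2 ⟨x, hxE, (Finset.mem_filter.1 hx).2⟩

/-- Support bound for subcodes of a code whose local groups are MDS with redundancy `d` and which
becomes MDS with redundancy `d + a` after merging local parities along `τ`. The subcodes considered
vanish on the first `t` groups. -/
theorem exists_support_bound {F Y : Type*} [Field F] [Fintype Y] {L r d a : ℕ}
    {C : Submodule F (Fin (L * (r + d) + a) → F)} {loc : Fin L → Fin (r + d) → Fin d → F}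
    (hloc : ∀ j, ∀ E : Finset (Fin (r + d)), E.card = d →
      LinearIndependent F (fun e : E => loc j e))
    (hCloc : ∀ j, ∀ c ∈ C, ∑ y, c (localCoord j y) • loc j y = 0)
    {glob : Y → Fin (d + a) → F}
    (hglob : ∀ E : Finset Y, E.card = d + a → LinearIndependent F (fun e : E => glob e))
    (hY : d + a ≤ Fintype.card Y) (τ : Fin (L * (r + d) + a) → Y)
    (hCglob : ∀ c ∈ C, ∑ x, c x • glob (τ x) = 0)
    (hτglob : ∀ x x', L * (r + d) ≤ x.val → τ x' = τ x → x' = x)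
    (hτloc : ∀ j (y : Fin (r + d)) x', y.val < r → τ x' = τ (localCoord j y) →
      x' = localCoord j y) (m t : ℕ) (hmt : t + m = L)
    {D : Submodule F (Fin (L * (r + d) + a) → F)} (hDC : D ≤ C) (hne : D ≠ ⊥)
    (hzero : ∀ c ∈ D, ∀ x, x.val < t * (r + d) → c x = 0)
    {E : Finset (Fin (L * (r + d) + a))} (hE : ∀ c ∈ D, ∀ x ∉ E, c x = 0) :
    ∃ v ≤ m, Module.finrank F D ≤ v * r ∧
      Module.finrank F D + a + v * d ≤ (E.filter fun x => t * (r + d) ≤ x.val).card := by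
  have hmerge : ∀ (t : ℕ) (D : Submodule F (Fin (L * (r + d) + a) → F)), D ≤ C → D ≠ ⊥ →
      (∀ c ∈ D, ∀ x, x.val < t * (r + d) → c x = 0) → (∀ c ∈ D, ∀ x ∉ E, c x = 0) →
      (∀ c ∈ D, (∀ x, (∀ x', τ x' = τ x → x' = x) → c x = 0) → c = 0) →
      d + a + Module.finrank F D ≤ (E.filter fun x => t * (r + d) ≤ x.val).card := by
    intro t D hDC hne hzero hE hinj
    refine add_finrank_le_card_support_of_merge hglob hY τ (fun c hc => hCglob c (hDC hc)) hinj
      hne fun c hc x hx => ?_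
    by_cases hxt : x.val < t * (r + d)
    · exact hzero c hc x hxt
    · exact hE c hc x fun hxE => hx (Finset.mem_filter.2 ⟨hxE, not_lt.1 hxt⟩)
  induction m generalizing t D with
  | zero =>
    obtain rfl : t = L := by omega
    exfalso
    have h1 := hmerge t D hDC hne hzero hE fun c hc h0 => by
      funext x
      by_cases hx : x.val < t * (r + d)
      · exact hzero c hc x hx
      · exact h0 x fun x' => hτglob x x' (not_lt.1 hx)
    have h2 : (E.filter fun x => t * (r + d) ≤ x.val).card ≤ a := by
      refine le_of_le_of_eq (Finset.card_le_card_of_injOn (t := Finset.range a)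
        (fun x => x.val - t * (r + d)) ?_ ?_) (Finset.card_range a)
      · intro x hx
        have := (Finset.mem_filter.1 hx).2
        have := x.2
        simp only [Finset.coe_range, Set.mem_Iio]
        omega
      · intro x hx y hy hxy
        have := (Finset.mem_filter.1 hx).2
        have := (Finset.mem_filter.1 hy).2
        simp only at hxy
        exact Fin.ext (by omega)
    have h3 : Module.finrank F D ≠ 0 := fun h => hne (Submodule.finrank_eq_zero.1 h)
    omega
  | succ m ih =>
    let j : Fin L := ⟨t, by omega⟩
    let p : (Fin (L * (r + d) + a) → F) →ₗ[F] (Fin (r + d) → F) :=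
      LinearMap.funLeft F F (localCoord j)
    let D' := (LinearMap.ker (p.domRestrict D)).map D.subtype
    have hD'D : D' ≤ D := Submodule.map_subtype_le _ _
    have hD'p : ∀ c ∈ D', ∀ y, c (localCoord j y) = 0 := by
      rintro _ ⟨c, hc, rfl⟩ y
      exact congrFun (LinearMap.mem_ker.1 hc) y
    have hdim : Module.finrank F (D.map p) + Module.finrank F D' = Module.finrank F D := by
      rw [← LinearMap.range_domRestrict, Submodule.finrank_map_subtype_eq]
      exact LinearMap.finrank_range_add_finrank_ker _
    let Eloc : Finset (Fin (r + d)) := Finset.univ.filter fun y => localCoord j y ∈ E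
    have hlocle : D.map p ≠ ⊥ → d + Module.finrank F (D.map p) ≤ Eloc.card := by
      intro hW
      refine add_finrank_le_card_support (hloc j) (by simp) ?_ hW ?_
      · rintro _ ⟨c, hc, rfl⟩
        exact hCloc j c (hDC hc)
      · rintro _ ⟨c, hc, rfl⟩ y hy
        exact hE c hc _ fun h => hy (Finset.mem_filter.2 ⟨Finset.mem_univ _, h⟩)
    have hElocle : Eloc.card ≤ r + d := le_of_le_of_eq (Finset.card_le_univ _) (Fintype.card_fin _)
    have hsucc : (t + 1) * (r + d) = t * (r + d) + (r + d) := Nat.succ_mul _ _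
    have hsplit : Eloc.card + (E.filter fun x => (t + 1) * (r + d) ≤ x.val).card ≤
        (E.filter fun x => t * (r + d) ≤ x.val).card := by
      rw [← Finset.card_image_of_injective Eloc (localCoord_injective (a := a) j),
        ← Finset.card_union_of_disjoint]
      · refine Finset.card_le_card fun x hx => ?_
        simp only [Finset.mem_union, Finset.mem_image, Finset.mem_filter, Eloc, Finset.mem_univ,
          true_and] at hx ⊢
        rcases hx with ⟨y, hy, rfl⟩ | ⟨hx, hxt⟩
        · exact ⟨hy, Nat.le_add_right _ _⟩
        · exact ⟨hx, by omega⟩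
      · refine Finset.disjoint_left.2 fun x hx hx' => ?_
        obtain ⟨y, _, rfl⟩ := Finset.mem_image.1 hx
        have h1 := (Finset.mem_filter.1 hx').2
        simp only [localCoord, j] at h1
        omega
    have hnext : ∀ c ∈ D, (∀ y, c (localCoord j y) = 0) →
        ∀ x, x.val < (t + 1) * (r + d) → c x = 0 := by
      intro c hc hcj x hx
      by_cases hxt : x.val < t * (r + d)
      · exact hzero c hc x hxt
      · have hx' : x = localCoord j ⟨x.val - t * (r + d), by omega⟩ :=
          Fin.ext (by simp only [localCoord, j]; omega)
        rw [hx']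
        exact hcj _
    by_cases hW : D.map p = ⊥
    · obtain ⟨v, hvm, hvr, hv⟩ := ih (t + 1) (by omega) hDC hne
        (fun c hc => hnext c hc fun y =>
          congrFun ((Submodule.eq_bot_iff _).1 hW _ (Submodule.mem_map_of_mem hc)) y) hE
      exact ⟨v, by omega, hvr, by omega⟩
    have hWcard := hlocle hW
    by_cases hD' : D' = ⊥
    · rw [hD', finrank_bot] at hdim
      refine ⟨1, by omega, by omega, ?_⟩
      have := hmerge t D hDC hne hzero hE fun c hc h0 => by
        have hp : p c = 0 := by
          refine eq_zero_of_card_support_le (hloc j) (by simp) (hCloc j c (hDC hc))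
            (E := Finset.univ.filter fun y => r ≤ y.val) ?_ ?_
          · intro y hy
            have hyr : y.val < r := by simpa using hy
            exact h0 _ fun x' => hτloc j y x' hyr
          · refine le_of_le_of_eq (Finset.card_le_card_of_injOn (t := Finset.range d)
              (fun y => y.val - r) ?_ ?_) (Finset.card_range d)
            · intro y hy
              have := (Finset.mem_filter.1 hy).2
              have := y.2
              simp only [Finset.coe_range, Set.mem_Iio]
              omega
            · intro y hy z hz hyz
              have := (Finset.mem_filter.1 hy).2
              have := (Finset.mem_filter.1 hz).2
              simp only at hyz
              exact Fin.ext (by omega)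
        exact (Submodule.eq_bot_iff _).1 hD' c ⟨⟨c, hc⟩, LinearMap.mem_ker.2 hp, rfl⟩
      omega
    · obtain ⟨v, hvm, hvr, hv⟩ := ih (t + 1) (by omega) (hD'D.trans hDC) hD'
        (fun c hc => hnext c (hD'D hc) (hD'p c hc)) fun c hc => hE c (hD'D hc)
      refine ⟨v + 1, by omega, ?_, ?_⟩ <;> rw [Nat.succ_mul] <;> omega

theorem lrcH_localCoord_apply {F : Type*} [Field F] {r d L a : ℕ} (P M : ℕ → ℕ → ℕ → F)
    (j : Fin L) (l : Fin d) (x : Fin (L * (r + d) + a)) :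
    lrcH F r (d + 1) L a P M (localCoord j l) x =
      if x.val < L * (r + d) ∧ x.val / (r + d) = j then
        lrcLocal F r (d + 1) (P j) l ⟨x.val % (r + d), Nat.mod_lt _ (by have := l.2; omega)⟩
      else 0 := by
  have hd : 0 < d := l.pos
  have h1 : (localCoord (a := a) j l).val < L * d := by
    have h : (j + 1) * d ≤ L * d := Nat.mul_le_mul_right d j.2
    have := l.2
    rw [Nat.succ_mul] at h
    simp only [localCoord]
    omega
  have h2 : (localCoord (a := a) j l).val / d = j := by
    simp only [localCoord]
    rw [mul_comm, Nat.mul_add_div hd, Nat.div_eq_of_lt l.2, add_zero]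
  have h3 : (localCoord (a := a) j l).val % d = l := by
    simp only [localCoord]
    rw [mul_comm, Nat.mul_add_mod, Nat.mod_eq_of_lt l.2]
  have hnc : r + (d + 1) - 1 = r + d := rfl
  simp only [lrcH, lrcLocal, Nat.add_sub_cancel, hnc, h1, h2, h3, if_true]
  by_cases hx : x.val < L * (r + d)
  · by_cases hj : x.val / (r + d) = j
    · simp [hx, hj]
    · simp [hx, hj, Ne.symm hj]
  · simp [hx]

theorem div_mul_add_mod_lt {r d L : ℕ} {x : ℕ} (h : x < L * (r + d)) (h' : x % (r + d) < r) :
    x / (r + d) * r + x % (r + d) < L * r := by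
  have h1 : x / (r + d) < L := Nat.div_lt_of_lt_mul (lt_of_lt_of_eq h (mul_comm _ _))
  have h2 : (x / (r + d) + 1) * r ≤ L * r := Nat.mul_le_mul_right r h1
  rw [Nat.succ_mul] at h2
  omega

/-- The coordinate of the code with parity-check matrix `lrcHMDS` onto which a coordinate of the
code with parity-check matrix `lrcH` is merged. -/
def mergeCoord (r d L a : ℕ) (x : Fin (L * (r + d) + a)) : Fin (L * r + d + a) :=
  if h : x.val < L * (r + d) then
    if h' : x.val % (r + d) < r then
      ⟨x.val / (r + d) * r + x.val % (r + d), (div_mul_add_mod_lt h h').trans_le (by omega)⟩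
    else
      ⟨L * r + (x.val % (r + d) - r), by
        have : x.val % (r + d) < r + d := Nat.mod_lt _ (Nat.pos_of_ne_zero fun h0 => by
          simp [h0] at h)
        omega⟩
  else ⟨L * r + d + (x.val - L * (r + d)), by omega⟩

theorem eq_of_mergeCoord_eq {r d L a : ℕ} {x x' : Fin (L * (r + d) + a)}
    (hx : x.val < L * (r + d) → x.val % (r + d) < r)
    (h : mergeCoord r d L a x' = mergeCoord r d L a x) : x' = x := by
  have hv := congrArg Fin.val h
  by_cases h1 : x.val < L * (r + d)
  · have h2 := hx h1
    have h3 := div_mul_add_mod_lt h1 h2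
    by_cases h1' : x'.val < L * (r + d)
    · by_cases h2' : x'.val % (r + d) < r
      · simp only [mergeCoord, h1, h2, h1', h2', dif_pos] at hv
        have hr : 0 < r := by omega
        have hdiv := congrArg (· / r) hv
        have hmod := congrArg (· % r) hv
        simp only [mul_comm _ r, Nat.mul_add_div hr, Nat.mul_add_mod, Nat.div_eq_of_lt h2,
          Nat.div_eq_of_lt h2', Nat.mod_eq_of_lt h2, Nat.mod_eq_of_lt h2', add_zero] at hdiv hmod
        refine Fin.ext ?_
        rw [← Nat.div_add_mod x'.val (r + d), ← Nat.div_add_mod x.val (r + d), hdiv, hmod]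
      · simp only [mergeCoord, h1, h2, h1', h2', dif_pos, dif_neg, not_false_iff] at hv
        omega
    · simp only [mergeCoord, h1, h2, h1', dif_pos, dif_neg, not_false_iff] at hv
      omega
  · by_cases h1' : x'.val < L * (r + d)
    · by_cases h2' : x'.val % (r + d) < r
      · have h3 := div_mul_add_mod_lt h1' h2'
        simp only [mergeCoord, h1, h1', h2', dif_pos, dif_neg, not_false_iff] at hv
        omega
      · have h3 : x'.val % (r + d) < r + d := Nat.mod_lt _ (Nat.pos_of_ne_zero fun h0 => by
          simp [h0] at h1')
        simp only [mergeCoord, h1, h1', h2', dif_pos, dif_neg, not_false_iff] at hv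
        omega
    · simp only [mergeCoord, h1, h1', dif_neg, not_false_iff] at hv
      exact Fin.ext (by omega)

theorem lrcHMDS_local_row {F : Type*} [Field F] {r d L a : ℕ} (P M : ℕ → ℕ → ℕ → F)
    (i : Fin (d + a)) (hi : i.val < d) (x : Fin (L * (r + d) + a)) :
    lrcHMDS F r (d + 1) L a P M i (mergeCoord r d L a x) =
      ∑ j : Fin L, lrcH F r (d + 1) L a P M (localCoord j ⟨i.val, hi⟩) x := by
  simp only [lrcH_localCoord_apply]
  by_cases h : x.val < L * (r + d)
  · have hL : x.val / (r + d) < L := Nat.div_lt_of_lt_mul (lt_of_lt_of_eq h (mul_comm _ _))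
    rw [Finset.sum_eq_single (⟨x.val / (r + d), hL⟩ : Fin L)
      (fun j _ hj => if_neg fun hj' => hj (Fin.ext hj'.2.symm)) (by simp), if_pos ⟨h, rfl⟩]
    by_cases h' : x.val % (r + d) < r
    · have h3 := div_mul_add_mod_lt h h'
      have hr : 0 < r := by omega
      have hdiv : (x.val / (r + d) * r + x.val % (r + d)) / r = x.val / (r + d) := by
        rw [mul_comm, Nat.mul_add_div hr, Nat.div_eq_of_lt h', add_zero]
      have hmod : (x.val / (r + d) * r + x.val % (r + d)) % r = x.val % (r + d) := by
        rw [mul_comm, Nat.mul_add_mod, Nat.mod_eq_of_lt h']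
      simp [lrcHMDS, lrcLocal, mergeCoord, h, h', h3, hi, hdiv, hmod]
    · have h4 : L * r + (x.val % (r + d) - r) = L * r + i.val ↔ x.val % (r + d) = r + i.val := by
        omega
      simp [lrcHMDS, lrcLocal, mergeCoord, h, h', -Nat.add_left_cancel_iff, -add_right_inj, h4]
  · rw [Finset.sum_eq_zero fun j _ => if_neg fun hj => h hj.1]
    have h4 : ¬ L * r + d + (x.val - L * (r + d)) < L * r := by omega
    have h5 : L * r + d + (x.val - L * (r + d)) ≠ L * r + i.val := by omega
    simp [lrcHMDS, mergeCoord, h, h4, h5]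

theorem lrcHMDS_global_row {F : Type*} [Field F] {r d L a : ℕ} (P M : ℕ → ℕ → ℕ → F)
    (i : Fin (d + a)) (hi : ¬ i.val < d) (x : Fin (L * (r + d) + a)) :
    lrcHMDS F r (d + 1) L a P M i (mergeCoord r d L a x) =
      lrcH F r (d + 1) L a P M
        (⟨L * d + (i.val - d), by have := i.2; omega⟩ : Fin (L * d + a)) x := by
  have hnc : r + (d + 1) - 1 = r + d := rfl
  have hrow : ¬ L * d + (i.val - d) < L * d := by omega
  have hrow' : L * d + (i.val - d) - L * d = i.val - d := by omega
  by_cases h : x.val < L * (r + d)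
  · by_cases h' : x.val % (r + d) < r
    · have h3 := div_mul_add_mod_lt h h'
      have hr : 0 < r := by omega
      have hdiv : (x.val / (r + d) * r + x.val % (r + d)) / r = x.val / (r + d) := by
        rw [mul_comm, Nat.mul_add_div hr, Nat.div_eq_of_lt h', add_zero]
      have hmod : (x.val / (r + d) * r + x.val % (r + d)) % r = x.val % (r + d) := by
        rw [mul_comm, Nat.mul_add_mod, Nat.mod_eq_of_lt h']
      simp only [lrcHMDS, lrcH, mergeCoord, Nat.add_sub_cancel, hnc, h, h', h3, hi, hdiv, hmod,
        hrow, hrow', if_true, if_false, dif_pos]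
    · have h3 : x.val % (r + d) < r + d := Nat.mod_lt _ (Nat.pos_of_ne_zero fun h0 => by
          simp [h0] at h)
      have h4 : ¬ L * r + (x.val % (r + d) - r) < L * r := by omega
      have h5 : L * r + (x.val % (r + d) - r) ≠ L * r + i.val := by omega
      simp only [lrcHMDS, lrcH, mergeCoord, Nat.add_sub_cancel, hnc, h, h', h4, h5,
        hrow, if_true, if_false, dif_pos, dif_neg, not_false_iff]
  · have h4 : ¬ L * r + d + (x.val - L * (r + d)) < L * r := by omega
    have h5 : L * r + d + (x.val - L * (r + d)) = L * r + i.val ↔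
        x.val = L * (r + d) + (i.val - d) := by omega
    simp only [lrcHMDS, lrcH, mergeCoord, Nat.add_sub_cancel, hnc, h, h4, h5,
      hrow, hrow', if_false, dif_neg, not_false_iff]

theorem sum_smul_lrcLocal_eq_zero {F : Type*} [Field F] {r d L a : ℕ} {P M : ℕ → ℕ → ℕ → F}
    {c : Fin (L * (r + d) + a) → F} (hc : (lrcH F r (d + 1) L a P M).mulVec c = 0) (j : Fin L) :
    ∑ y : Fin (r + d), c (localCoord j y) •
      (fun l : Fin d => lrcLocal F r (d + 1) (P j) l y) = 0 := by
  funext l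
  have hrow : ∑ x, lrcH F r (d + 1) L a P M (localCoord j l) x * c x = 0 :=
    congrFun hc (localCoord j l)
  simp only [lrcH_localCoord_apply] at hrow
  rw [Finset.sum_apply, Pi.zero_apply, ← hrow]
  refine Finset.sum_of_injOn (localCoord j) (localCoord_injective j).injOn (by simp) ?_ ?_
  · intro x _ hx
    rw [if_neg, zero_mul]
    rintro ⟨h, hj⟩
    refine hx ⟨⟨x.val % (r + d), Nat.mod_lt _ (by have := l.2; omega)⟩, by simp, Fin.ext ?_⟩
    simp only [localCoord]
    rw [← hj, Nat.div_add_mod']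
  · intro y _
    have hpos : 0 < r + d := y.pos
    have h1 : (localCoord (a := a) j y).val < L * (r + d) := by
      have h : (j + 1) * (r + d) ≤ L * (r + d) := Nat.mul_le_mul_right _ j.2
      have := y.2
      rw [Nat.succ_mul] at h
      simp only [localCoord]
      omega
    have h2 : (localCoord (a := a) j y).val / (r + d) = j := by
      simp only [localCoord]
      rw [mul_comm, Nat.mul_add_div hpos, Nat.div_eq_of_lt y.2, add_zero]
    have h3 : (localCoord (a := a) j y).val % (r + d) = y := by
      simp only [localCoord]
      rw [mul_comm, Nat.mul_add_mod, Nat.mod_eq_of_lt y.2]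
    rw [if_pos ⟨h1, h2⟩]
    simp only [h3, Pi.smul_apply, smul_eq_mul, mul_comm, Fin.eta]

theorem sum_smul_lrcHMDS_eq_zero {F : Type*} [Field F] {r d L a : ℕ} {P M : ℕ → ℕ → ℕ → F}
    {c : Fin (L * (r + d) + a) → F} (hc : (lrcH F r (d + 1) L a P M).mulVec c = 0) :
    ∑ x, c x • (fun i : Fin (d + a) =>
      lrcHMDS F r (d + 1) L a P M i (mergeCoord r d L a x)) = 0 := by
  have hrow : ∀ i : Fin (L * d + a), ∑ x, c x * lrcH F r (d + 1) L a P M i x = 0 := by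
    intro i
    have h : ∑ x, lrcH F r (d + 1) L a P M i x * c x = 0 := congrFun hc i
    exact (Finset.sum_congr rfl fun x _ => mul_comm _ _).trans h
  funext i
  simp only [Finset.sum_apply, Pi.smul_apply, smul_eq_mul, Pi.zero_apply]
  by_cases hi : i.val < d
  · simp only [lrcHMDS_local_row P M i hi, Finset.mul_sum]
    rw [Finset.sum_comm]
    exact Finset.sum_eq_zero fun j _ => hrow _
  · simp only [lrcHMDS_global_row P M i hi]
    exact hrow _

/-- Lower bound on the support of a nonzero subcode of an LRC with parity-check matrix `lrcH`. -/
theorem lrc_exists_support_bound {F : Type*} [Field F] {r d L a : ℕ} {P M : ℕ → ℕ → ℕ → F}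
    (hMDS : ∀ E : Finset (Fin (L * r + d + a)), E.card = d + a →
      LinearIndependent F (fun e : E => fun i => lrcHMDS F r (d + 1) L a P M i e.1))
    (hlocal : ∀ j < L, ∀ E : Finset (Fin (r + d)), E.card = d →
      LinearIndependent F (fun e : E => fun i => lrcLocal F r (d + 1) (P j) i e.1))
    {D : Submodule F (Fin (L * (r + d) + a) → F)}
    (hD : ∀ c ∈ D, (lrcH F r (d + 1) L a P M).mulVec c = 0) (hne : D ≠ ⊥)
    {E : Finset (Fin (L * (r + d) + a))} (hE : ∀ c ∈ D, ∀ x ∉ E, c x = 0) :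
    ∃ v ≤ L, Module.finrank F D ≤ v * r ∧ Module.finrank F D + a + v * d ≤ E.card := by
  obtain ⟨v, hvL, hvr, hv⟩ := exists_support_bound (C := D)
    (loc := fun j y l => lrcLocal F r (d + 1) (P j) l y)
    (fun j => hlocal j j.2) (fun j c hc => sum_smul_lrcLocal_eq_zero (hD c hc) j)
    (glob := fun y i => lrcHMDS F r (d + 1) L a P M i y) hMDS
    (by rw [Fintype.card_fin]; omega) (mergeCoord r d L a)
    (fun c hc => sum_smul_lrcHMDS_eq_zero (hD c hc))
    (fun x x' hx => eq_of_mergeCoord_eq fun h => absurd hx (not_le.2 h))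
    (fun j y x' hy => eq_of_mergeCoord_eq fun _ => by
      simp only [localCoord]
      rwa [mul_comm, Nat.mul_add_mod, Nat.mod_eq_of_lt y.2])
    L 0 (zero_add L) le_rfl hne (by simp) hE
  exact ⟨v, hvL, hvr, hv.trans (Finset.card_filter_le _ _)⟩

theorem finrank_ker_lrcH {F : Type*} [Field F] {r d L a : ℕ} {P M : ℕ → ℕ → ℕ → F}
    (hMDS : ∀ E : Finset (Fin (L * r + d + a)), E.card = d + a →
      LinearIndependent F (fun e : E => fun i => lrcHMDS F r (d + 1) L a P M i e.1))
    (hlocal : ∀ j < L, ∀ E : Finset (Fin (r + d)), E.card = d →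
      LinearIndependent F (fun e : E => fun i => lrcLocal F r (d + 1) (P j) i e.1)) :
    Module.finrank F (LinearMap.ker (lrcH F r (d + 1) L a P M).mulVecLin) = L * r := by
  refine le_antisymm ?_ ?_
  · by_cases hne : LinearMap.ker (lrcH F r (d + 1) L a P M).mulVecLin = ⊥
    · rw [hne, finrank_bot]
      exact Nat.zero_le _
    · obtain ⟨v, hvL, hvr, -⟩ := lrc_exists_support_bound hMDS hlocal
        (fun c hc => LinearMap.mem_ker.1 hc) hne (E := Finset.univ) (by simp)
      exact hvr.trans (Nat.mul_le_mul_right r hvL)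
  · have h1 := LinearMap.finrank_range_add_finrank_ker (lrcH F r (d + 1) L a P M).mulVecLin
    have h2 : Module.finrank F (LinearMap.range (lrcH F r (d + 1) L a P M).mulVecLin) ≤
        L * d + a := by
      refine (Submodule.finrank_le _).trans_eq ?_
      rw [Module.finrank_fintype_fun_eq_card, Fintype.card_fin]
      rfl
    have h3 : Module.finrank F (Fin (L * (r + (d + 1) - 1) + a) → F) = L * r + L * d + a := by
      rw [Module.finrank_fintype_fun_eq_card, Fintype.card_fin, ← mul_add]
      rfl
    omega

/-- Shortened codes of the LRC are small enough for its matroid to be uniformly dense. -/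
theorem lrc_density {F : Type*} [Field F] {r d L a : ℕ} {P M : ℕ → ℕ → ℕ → F}
    (hMDS : ∀ E : Finset (Fin (L * r + d + a)), E.card = d + a →
      LinearIndependent F (fun e : E => fun i => lrcHMDS F r (d + 1) L a P M i e.1))
    (hlocal : ∀ j < L, ∀ E : Finset (Fin (r + d)), E.card = d →
      LinearIndependent F (fun e : E => fun i => lrcLocal F r (d + 1) (P j) i e.1))
    {D : Submodule F (Fin (L * (r + d) + a) → F)}
    (hD : ∀ c ∈ D, (lrcH F r (d + 1) L a P M).mulVec c = 0)
    {A : Finset (Fin (L * (r + d) + a))} (hA : ∀ c ∈ D, ∀ x ∈ A, c x = 0) :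
    L * r * A.card + (L * (r + d) + a) * Module.finrank F D ≤
      (L * (r + d) + a) * (L * r) := by
  have hcompl := Finset.card_add_card_compl A
  rw [Fintype.card_fin] at hcompl
  by_cases hne : D = ⊥
  · rw [hne, finrank_bot, mul_zero, add_zero, mul_comm]
    exact Nat.mul_le_mul_right _ (by omega)
  · obtain ⟨v, hvL, hvr, hv⟩ := lrc_exists_support_bound hMDS hlocal hD hne (E := Aᶜ)
      fun c hc x hx => hA c hc x (by simpa using hx)
    have h1 : Module.finrank F D * (L * d) ≤ v * r * (L * d) := Nat.mul_le_mul_right _ hvr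
    have h2 : Module.finrank F D * a ≤ L * r * a :=
      Nat.mul_le_mul_right a (hvr.trans (Nat.mul_le_mul_right r hvL))
    have h3 : L * r * (Module.finrank F D + a + v * d) ≤ L * r * (Aᶜ).card :=
      Nat.mul_le_mul_left _ hv
    have h4 : (L * (r + d) + a) * Module.finrank F D ≤ L * r * (Aᶜ).card := by nlinarith
    have h5 : (L * (r + d) + a) * (L * r) = (A.card + (Aᶜ).card) * (L * r) := by rw [hcompl]
    rw [h5]
    linarith
/-- Under the distance-optimal `(r,δ)` information locality code setup
(each local code is an `[r+δ−1,r]` MDS code and `H^MDS` is the parity-check matrix of an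
`[n',k]` MDS code), the code `C = ker H` has dimension `k = L_c·r` and there exist `n`
information sets of `C` such that every coordinate belongs to exactly `k` of them; i.e. an
MDS-PIR capacity-achieving matrix `Λ_{k,n}(C)` exists. -/
theorem lrc_mds_pir_capacity_achieving (F : Type*) [Field F] [Fintype F]
    (r δ Lc a : ℕ) (hr : 1 ≤ r) (hδ : 2 ≤ δ) (hLc : 1 ≤ Lc)
    (P M : ℕ → ℕ → ℕ → F)
    (hMDS : ∀ E : Finset (Fin (Lc * r + (δ - 1) + a)), E.card = (δ - 1) + a →
      LinearIndependent F (fun e : E => fun i => lrcHMDS F r δ Lc a P M i e.1))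
    (hlocal : ∀ j < Lc, ∀ E : Finset (Fin (r + δ - 1)), E.card = δ - 1 →
      LinearIndependent F (fun e : E => fun i => lrcLocal F r δ (P j) i e.1)) :
    Module.finrank F (LinearMap.ker (lrcH F r δ Lc a P M).mulVecLin) = Lc * r ∧
      (∃ I : Fin (Lc * (r + δ - 1) + a) → Finset (Fin (Lc * (r + δ - 1) + a)),
        (∀ i, IsInformationSet (LinearMap.ker (lrcH F r δ Lc a P M).mulVecLin) (I i)) ∧
        ∀ j, (Finset.univ.filter fun i => j ∈ I i).card = Lc * r) ∧
      ∃ Λ : Fin (Lc * (r + δ - 1) + a) → Fin (Lc * (r + δ - 1) + a) → Bool,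
        IsMDSPIRCapacityAchievingMatrix
          (LinearMap.ker (lrcH F r δ Lc a P M).mulVecLin) (Lc * r) Λ := by
  obtain ⟨d, rfl⟩ : ∃ d, δ = d + 1 := ⟨δ - 1, by omega⟩
  have hdim := finrank_ker_lrcH (d := d) hMDS hlocal
  obtain ⟨I, hI, hcov⟩ := exists_balanced_informationSets
    (LinearMap.ker (lrcH F r (d + 1) Lc a P M).mulVecLin) (Fintype.card_fin _)
    (fun D hD A hA => by
      rw [hdim]
      exact lrc_density (d := d) hMDS hlocal (fun c hc => LinearMap.mem_ker.1 (hD hc)) hA)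
  rw [hdim] at hcov
  refine ⟨hdim, ⟨I, hI, fun j => ?_⟩, fun i x => decide (x ∈ I i), ⟨fun j => ?_, fun i =>
    ⟨I i, hI i, fun j hj => decide_eq_true hj⟩⟩, ?_⟩
  · convert hcov j
  · rw [← hcov j]
    congr 1
    ext i
    simp
  · rw [hdim]
end

section
/- Let C be an [n,k] code and C̄ an [n,k̄] code over a finite field F, and let C̃ = C ∘ C̄ be their Hadamard product, of dimension k̃. Suppose there exist k information sets of C̃ and n−k̃ information sets of C such that every coordinate j ∈ {1,…,n} belongs to exactly k sets of the combined collection (counted with multiplicity). Then k·d_s^C ≥ (n−k̃)·s for every s ∈ {1,…,k}, and d_s^{C̃} ≥ s for every s ∈ {1,…,k̃}. -/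
open scoped Classical

/-- The Hadamard product `C ∘ D` of two subspaces of `F^X`: the span of all componentwise
products of an element of `C` and an element of `D`. -/
def hadamardCode {X F : Type*} [Fintype X] [Field F]
    (C D : Submodule F (X → F)) : Submodule F (X → F) :=
  Submodule.span F {z | ∃ x ∈ C, ∃ y ∈ D, z = fun j => x j * y j}

/-- The support `χ(D)` of a linear subspace `D ⊆ F^X`. -/
noncomputable def suppFinset {X F : Type*} [Fintype X] [Field F]
    (D : Submodule F (X → F)) : Finset X :=
  Finset.univ.filter fun j => ∃ x ∈ D, x j ≠ 0

/-- The `s`-th generalized Hamming weight of the code `C`. -/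
noncomputable def genHammingWeight {F : Type*} [Field F] [Fintype F] {n : ℕ}
    (C : Submodule F (Fin n → F)) (s : ℕ) : ℕ :=
  sInf {w : ℕ | ∃ D : Submodule F (Fin n → F), D ≤ C ∧ Module.finrank F D = s ∧
    (suppFinset D).card = w}

/-- A subspace of a code whose words are determined by their values on `J` has dimension at most
the number of coordinates of `J` in its support. -/
theorem finrank_le_card_inter_suppFinset {X F : Type*} [Fintype X] [DecidableEq X] [Field F]
    (D : Submodule F (X → F)) (J : Finset X)
    (hJ : ∀ x ∈ D, (∀ i ∈ J, x i = 0) → x = 0) :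
    Module.finrank F D ≤ (J ∩ suppFinset D).card := by
  let f : D →ₗ[F] ((J ∩ suppFinset D : Finset X) → F) :=
    (LinearMap.funLeft F F (fun i : (J ∩ suppFinset D : Finset X) => (i : X))).comp D.subtype
  have hf : Function.Injective f := by
    rw [injective_iff_map_eq_zero]
    rintro ⟨x, hx⟩ h
    refine Subtype.ext (hJ x hx fun i hi => ?_)
    by_contra hne
    have hmem : i ∈ J ∩ suppFinset D :=
      Finset.mem_inter.2 ⟨hi, Finset.mem_filter.2 ⟨Finset.mem_univ i, x, hx, hne⟩⟩
    exact hne (congrFun h ⟨i, hmem⟩)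
  simpa only [Module.finrank_fintype_fun_eq_card, Fintype.card_coe] using
    LinearMap.finrank_le_finrank_of_injective hf

/-- The generalized Hamming weight is attained. -/
theorem exists_card_suppFinset_eq_genHammingWeight {F : Type*} [Field F] [Fintype F] {n : ℕ}
    (C : Submodule F (Fin n → F)) {s : ℕ} (hs : s ≤ Module.finrank F C) :
    ∃ D : Submodule F (Fin n → F), D ≤ C ∧ Module.finrank F D = s ∧
      (suppFinset D).card = genHammingWeight C s := by
  refine Nat.sInf_mem (s := {w : ℕ | ∃ D : Submodule F (Fin n → F), D ≤ C ∧
    Module.finrank F D = s ∧ (suppFinset D).card = w}) ?_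
  obtain ⟨f, hf⟩ := exists_linearIndependent_of_le_finrank hs
  refine ⟨_, Submodule.span F (Set.range (C.subtype ∘ f)), ?_, ?_, rfl⟩
  · rw [Submodule.span_le]
    rintro _ ⟨i, rfl⟩
    exact (f i).2
  · simpa using finrank_span_eq_card (hf.map' C.subtype C.ker_subtype)

/-- A subcode `D` has dimension at most the number of coordinates in its support that belong to a
given information set of the code. -/
theorem IsInformationSet.finrank_le_card_inter_suppFinset {X F : Type*} [Fintype X] [DecidableEq X] [Field F]
    {C D : Submodule F (X → F)} {I : Finset X} (hI : IsInformationSet C I) (hD : D ≤ C) :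
    Module.finrank F D ≤ (I ∩ suppFinset D).card :=
  _root_.finrank_le_card_inter_suppFinset D I fun x hx h =>
    congrArg Subtype.val (hI.2 ⟨x, hD hx⟩ 0 h)

/-- Let `C` be an `[n,k]` code, `C̄` an `[n,k̄]` code, and `C̃ = C ∘ C̄` of
dimension `k̃`.  If there exist `k` information sets of `C̃` and `n−k̃` information sets of `C`
such that every coordinate belongs to exactly `k` sets of the combined collection (with
multiplicity), then `k·d_s^C ≥ (n−k̃)·s` for all `s ∈ {1,…,k}` and `d_s^{C̃} ≥ s` for all
`s ∈ {1,…,k̃}`. -/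
theorem pir_max_rate_matrix_necessary {F : Type*} [Field F] [Fintype F] {n k kbar ktil : ℕ}
    (C Cbar : Submodule F (Fin n → F))
    (hk : Module.finrank F C = k) (hkbar : Module.finrank F Cbar = kbar)
    (hktil : Module.finrank F (hadamardCode C Cbar) = ktil)
    (Itil : Fin k → Finset (Fin n)) (I : Fin (n - ktil) → Finset (Fin n))
    (hItil : ∀ i, IsInformationSet (hadamardCode C Cbar) (Itil i))
    (hI : ∀ i, IsInformationSet C (I i))
    (hcount : ∀ j : Fin n,
      (Finset.univ.filter fun i : Fin k => j ∈ Itil i).card +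
        (Finset.univ.filter fun i : Fin (n - ktil) => j ∈ I i).card = k) :
    (∀ s, 1 ≤ s → s ≤ k → (n - ktil) * s ≤ k * genHammingWeight C s) ∧
      ∀ s, 1 ≤ s → s ≤ ktil → s ≤ genHammingWeight (hadamardCode C Cbar) s := by
  refine ⟨fun s _ hs => ?_, fun s _ hs => ?_⟩
  · obtain ⟨D, hDC, hDs, hD⟩ :=
      exists_card_suppFinset_eq_genHammingWeight C (hs.trans_eq hk.symm)
    rw [← hD, ← hDs]
    calc (n - ktil) * Module.finrank F D
        = ∑ _i : Fin (n - ktil), Module.finrank F D := by simp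
      _ ≤ ∑ i, (I i ∩ suppFinset D).card :=
          Finset.sum_le_sum fun i _ => (hI i).finrank_le_card_inter_suppFinset hDC
      _ = ∑ j ∈ suppFinset D, (Finset.univ.filter fun i => j ∈ I i).card := by
          simp_rw [Finset.inter_comm (I _), ← Finset.filter_mem_eq_inter]
          exact Finset.sum_card_bipartiteAbove_eq_sum_card_bipartiteBelow fun i j => j ∈ I i
      _ ≤ ∑ _j ∈ suppFinset D, k :=
          Finset.sum_le_sum fun j _ => (Nat.le_add_left _ _).trans_eq (hcount j)
      _ = k * (suppFinset D).card := by simp [mul_comm]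
  · obtain ⟨D, -, hDs, hD⟩ :=
      exists_card_suppFinset_eq_genHammingWeight (hadamardCode C Cbar) (hs.trans_eq hktil.symm)
    rw [← hD, ← hDs]
    simpa using finrank_le_card_inter_suppFinset D Finset.univ fun x _ h =>
      funext fun i => h i (Finset.mem_univ i)
end

section
/- Let U ⊆ GF(2)^{n₁} be a linear code of dimension k₁ with n₁ ≥ k₁ + 2, and let C = {(u, u + c·𝟙) : u ∈ U, c ∈ GF(2)} ⊆ GF(2)^{2n₁} be the (U | U+V) code with V the [n₁,1] binary repetition code (𝟙 is the all-one vector of length n₁). Then the Hadamard product C ∘ C is a proper subspace of GF(2)^{2n₁}, i.e., dim(C ∘ C) ≤ 2n₁ − 1. -/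
open scoped Classical

/-- The `(U | U+V)` code obtained from a binary code `U ⊆ GF(2)^{n₁}` and the `[n₁,1]`
repetition code `V`: the set of words `(u, u + c·𝟙)` with `u ∈ U` and `c ∈ GF(2)`, as a
subspace of `GF(2)^{2n₁}` (the two halves of the coordinates are the two summands of
`Fin n₁ ⊕ Fin n₁`). -/
def UUVCode {n₁ : ℕ} (U : Submodule (ZMod 2) (Fin n₁ → ZMod 2)) :
    Submodule (ZMod 2) ((Fin n₁ ⊕ Fin n₁) → ZMod 2) where
  carrier := {z | ∃ u ∈ U, ∃ c : ZMod 2, z = Sum.elim u fun i => u i + c}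
  zero_mem' := ⟨0, U.zero_mem, 0, by funext i; cases i <;> simp⟩
  add_mem' := by
    rintro z w ⟨u, hu, c, rfl⟩ ⟨u', hu', c', rfl⟩
    exact ⟨u + u', U.add_mem hu hu', c + c', by
      funext i; cases i <;> simp <;> ring⟩
  smul_mem' := by
    rintro s z ⟨u, hu, c, rfl⟩
    exact ⟨s • u, U.smul_mem s hu, s * c, by
      funext i; cases i <;> simp [smul_eq_mul] <;> ring⟩

/-- The difference of the two halves of a word of `C ∘ C`, where `C` is the `(U | U+V)` code,
lies in `U + ⟨𝟙⟩`. -/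
theorem hadamardCode_UUVCode_le_comap {n₁ : ℕ} (U : Submodule (ZMod 2) (Fin n₁ → ZMod 2)) :
    hadamardCode (UUVCode U) (UUVCode U) ≤
      (U ⊔ Submodule.span (ZMod 2) {1}).comap
        (LinearMap.funLeft (ZMod 2) (ZMod 2) Sum.inr -
          LinearMap.funLeft (ZMod 2) (ZMod 2) Sum.inl) := by
  refine Submodule.span_le.2 ?_
  rintro _ ⟨_, ⟨u, hu, c, rfl⟩, _, ⟨v, hv, d, rfl⟩, rfl⟩
  refine Submodule.mem_sup.2 ⟨d • u + c • v, U.add_mem (U.smul_mem d hu) (U.smul_mem c hv),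
    (c * d) • 1, Submodule.smul_mem _ _ (Submodule.mem_span_singleton_self _), ?_⟩
  ext i
  simp [LinearMap.funLeft_apply]
  ring

/-- Let `U ⊆ GF(2)^{n₁}` be a linear code of dimension `k₁` with
`n₁ ≥ k₁ + 2` and let `C` be the `(U | U+V)` code with `V` the `[n₁,1]` binary repetition code.
Then the Hadamard product `C ∘ C` is a proper subspace of `GF(2)^{2n₁}`:
`dim(C ∘ C) ≤ 2n₁ − 1`. -/
theorem uuv_hadamard_proper {n₁ k₁ : ℕ}
    (U : Submodule (ZMod 2) (Fin n₁ → ZMod 2))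
    (hU : Module.finrank (ZMod 2) U = k₁) (hn : k₁ + 2 ≤ n₁) :
    Module.finrank (ZMod 2) (hadamardCode (UUVCode U) (UUVCode U)) ≤ 2 * n₁ - 1 := by
  have hlt : hadamardCode (UUVCode U) (UUVCode U) < ⊤ := by
    refine lt_top_iff_ne_top.2 fun htop => ?_
    have hsup : U ⊔ Submodule.span (ZMod 2) {(1 : Fin n₁ → ZMod 2)} = ⊤ := by
      refine Submodule.eq_top_iff'.2 fun w => ?_
      have hw := hadamardCode_UUVCode_le_comap U
        (htop ▸ Submodule.mem_top :
          Sum.elim (0 : Fin n₁ → ZMod 2) w ∈ hadamardCode (UUVCode U) (UUVCode U))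
      convert Submodule.mem_comap.1 hw
      ext i
      simp [LinearMap.funLeft_apply]
    have hdim := Submodule.finrank_add_le_finrank_add_finrank U
      (Submodule.span (ZMod 2) {(1 : Fin n₁ → ZMod 2)})
    have hone := finrank_span_le_card (R := ZMod 2) {(1 : Fin n₁ → ZMod 2)}
    rw [hsup, finrank_top, Module.finrank_fin_fun, hU] at hdim
    simp only [Set.toFinset_singleton, Finset.card_singleton] at hone
    omega
  have h := Submodule.finrank_lt hlt.ne
  rw [Module.finrank_fintype_fun_eq_card, Fintype.card_sum, Fintype.card_fin] at h
  omega
end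

section
/- Let U ⊆ GF(2)^{n₁} be a linear code of dimension k₁, and let C = {(u, u + c·𝟙) : u ∈ U, c ∈ GF(2)} ⊆ GF(2)^{2n₁} be the (U | U+V) code with V the [n₁,1] binary repetition code. Then dim(C ∘ C) ≤ k₁ + n₁ + 1 if n₁ − k₁ ≤ k₁(k₁−1)/2, and dim(C ∘ C) ≤ 2k₁ + k₁(k₁−1)/2 + 1 otherwise; equivalently, dim(C ∘ C) ≤ 2k₁ + 1 + min(n₁ − k₁, k₁(k₁−1)/2). -/
open scoped Classical

open scoped Pointwise in
/-- The square of a `k`-dimensional subspace of a commutative algebra has dimension at most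
`k (k + 1) / 2`. -/
theorem finrank_mul_self_le_choose {F A : Type*} [Field F] [CommRing A] [Algebra F A]
    (U : Submodule F A) [FiniteDimensional F U] :
    Module.finrank F ↥(U * U) ≤ (Module.finrank F U + 1).choose 2 := by
  let b : Fin (Module.finrank F U) → A := fun i => (Module.finBasis F U i : A)
  have hb : Submodule.span F (Set.range b) = U := by
    have h := congrArg (Submodule.map U.subtype) (Module.finBasis F U).span_eq
    rwa [Submodule.map_span, ← Set.range_comp, Submodule.map_top, Submodule.range_subtype] at h
  let f : Sym2 (Fin (Module.finrank F U)) → A := fun s => (s.map b).mul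
  have hle : U * U ≤ Submodule.span F (Set.range f) := by
    have hmul : U * U = Submodule.span F (Set.range b * Set.range b) := by
      rw [← Submodule.span_mul_span, hb]
    rw [hmul]
    refine Submodule.span_mono ?_
    rintro _ ⟨_, ⟨i, rfl⟩, _, ⟨j, rfl⟩, rfl⟩
    exact ⟨s(i, j), by simp [f]⟩
  have : FiniteDimensional F (Submodule.span F (Set.range f)) :=
    FiniteDimensional.span_of_finite F (Set.finite_range f)
  calc Module.finrank F ↥(U * U)
      ≤ Module.finrank F (Submodule.span F (Set.range f)) := Submodule.finrank_mono hle
    _ ≤ Fintype.card (Sym2 (Fin (Module.finrank F U))) := finrank_range_le_card f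
    _ = (Module.finrank F U + 1).choose 2 := by rw [Sym2.card, Fintype.card_fin]

/-- The Hadamard square of the `(U | U+V)` code is contained in the sum of the diagonal copy of
the Hadamard square of `U` and the copy of `U + ⟨𝟙⟩` supported on the second half. -/
theorem hadamardCode_uuvCode_le {n : ℕ} (U : Submodule (ZMod 2) (Fin n → ZMod 2)) :
    hadamardCode (UUVCode U) (UUVCode U) ≤
      (U * U).map (LinearMap.funLeft (ZMod 2) (ZMod 2) (Sum.elim id id)) ⊔
      (U ⊔ Submodule.span (ZMod 2) {1}).map
        ((LinearEquiv.sumArrowLequivProdArrow (Fin n) (Fin n) (ZMod 2) (ZMod 2)).symm.toLinearMap ∘ₗ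
          LinearMap.inr (ZMod 2) (Fin n → ZMod 2) (Fin n → ZMod 2)) := by
  refine Submodule.span_le.2 ?_
  rintro _ ⟨_, ⟨u, hu, c, rfl⟩, _, ⟨v, hv, d, rfl⟩, rfl⟩
  refine Submodule.mem_sup.2 ⟨_, Submodule.mem_map_of_mem (Submodule.mul_mem_mul hu hv), _,
    Submodule.mem_map_of_mem (Submodule.add_mem_sup
      (U.add_mem (U.smul_mem d hu) (U.smul_mem c hv))
      (Submodule.smul_mem _ (c * d) (Submodule.mem_span_singleton_self 1))), ?_⟩
  funext i
  cases i <;> simp [LinearMap.funLeft_apply]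
  ring

theorem finrank_hadamardCode_uuvCode_le {n : ℕ} (U : Submodule (ZMod 2) (Fin n → ZMod 2)) :
    Module.finrank (ZMod 2) (hadamardCode (UUVCode U) (UUVCode U)) ≤
      Module.finrank (ZMod 2) ↥(U * U) + (Module.finrank (ZMod 2) U + 1) := by
  refine (Submodule.finrank_mono (hadamardCode_uuvCode_le U)).trans ?_
  refine (Submodule.finrank_add_le_finrank_add_finrank _ _).trans ?_
  refine add_le_add (Submodule.finrank_map_le _ _) ((Submodule.finrank_map_le _ _).trans ?_)
  refine (Submodule.finrank_add_le_finrank_add_finrank _ _).trans ?_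
  gcongr
  simpa using finrank_span_le_card (R := ZMod 2) ({1} : Set (Fin n → ZMod 2))

/-- Let `U ⊆ GF(2)^{n₁}` be a linear code of dimension `k₁` and let `C` be
the `(U | U+V)` code with `V` the `[n₁,1]` binary repetition code.  Then
`dim(C ∘ C) ≤ k₁ + n₁ + 1` if `n₁ − k₁ ≤ C(k₁,2)` and `dim(C ∘ C) ≤ 2k₁ + C(k₁,2) + 1`
otherwise; equivalently, `dim(C ∘ C) ≤ 2k₁ + 1 + min (n₁ − k₁) (C(k₁,2))`. -/
theorem uuv_hadamard_dim_bound {n₁ k₁ : ℕ}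
    (U : Submodule (ZMod 2) (Fin n₁ → ZMod 2))
    (hU : Module.finrank (ZMod 2) U = k₁) :
    ((n₁ - k₁ ≤ k₁.choose 2 →
        Module.finrank (ZMod 2) (hadamardCode (UUVCode U) (UUVCode U)) ≤ k₁ + n₁ + 1) ∧
      (k₁.choose 2 < n₁ - k₁ →
        Module.finrank (ZMod 2) (hadamardCode (UUVCode U) (UUVCode U)) ≤
          2 * k₁ + k₁.choose 2 + 1)) ∧
    Module.finrank (ZMod 2) (hadamardCode (UUVCode U) (UUVCode U)) ≤
      2 * k₁ + 1 + min (n₁ - k₁) (k₁.choose 2) := by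
  have h := finrank_hadamardCode_uuvCode_le U
  have hsq := finrank_mul_self_le_choose U
  have hn : Module.finrank (ZMod 2) ↥(U * U) ≤ n₁ := by
    simpa using Submodule.finrank_le (U * U)
  have hk : k₁ ≤ n₁ := by
    simpa [hU] using Submodule.finrank_le U
  rw [hU] at h hsq
  rw [Nat.choose_succ_succ' k₁ 1, Nat.choose_one_right] at hsq
  norm_num at hsq
  omega
end

section
/- Let n, k, ν, κ, f be positive integers with k·ν ≤ κ·n and κ < ν (these imply k < n). Then, as real numbers, ((ν−κ)·k)/(κ·n) · (1 − (κ/ν)^f)^{−1} ≤ ((n−k)/n) · (1 − (k/n)^f)^{−1}; that is, the PIR rate achieved by Protocol 1 with a PIR achievable rate matrix Λ_{κ,ν} never exceeds the finite MDS-PIR capacity for f files. -/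
theorem one_sub_mul_inv_one_sub_pow {K : Type*} [Field K] {x : K} (hx : x ≠ 1) (f : ℕ) :
    (1 - x) * (1 - x ^ f)⁻¹ = (∑ i ∈ Finset.range f, x ^ i)⁻¹ := by
  rw [← mul_neg_geom_sum, mul_inv, mul_inv_cancel_left₀ (sub_ne_zero.mpr hx.symm)]


/-- For positive integers `n, k, ν, κ, f` with `k·ν ≤ κ·n` and `κ < ν`, the
PIR rate of Protocol 1, `((ν−κ)k)/(κn) · (1 − (κ/ν)^f)⁻¹`, never exceeds the finite MDS-PIR
capacity `((n−k)/n) · (1 − (k/n)^f)⁻¹` for `f` files. -/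
theorem protocol1_rate_le_mds_pir_capacity (n k ν κ f : ℕ)
    (hn : 0 < n) (hk : 0 < k) (hν : 0 < ν) (hκ : 0 < κ) (hf : 0 < f)
    (h1 : k * ν ≤ κ * n) (h2 : κ < ν) :
    ((ν : ℝ) - κ) * k / (κ * n) * (1 - ((κ : ℝ) / ν) ^ f)⁻¹ ≤
      ((n : ℝ) - k) / n * (1 - ((k : ℝ) / n) ^ f)⁻¹ := by
  have hn' : (0 : ℝ) < n := by exact_mod_cast hn
  have hν' : (0 : ℝ) < ν := by exact_mod_cast hν
  have hκ' : (0 : ℝ) < κ := by exact_mod_cast hκ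
  have hk' : (0 : ℝ) < k := by exact_mod_cast hk
  have hx : (κ : ℝ) / ν < 1 := (div_lt_one hν').mpr (by exact_mod_cast h2)
  have hyx : (k : ℝ) / n ≤ κ / ν := (div_le_div_iff₀ hn' hν').mpr (by exact_mod_cast h1)
  have hl : ((ν : ℝ) - κ) * k / (κ * n) = (k / n) / (κ / ν) * (1 - κ / ν) := by
    field_simp
  have hr : ((n : ℝ) - k) / n = 1 - k / n := by
    field_simp
  rw [hl, hr, mul_assoc, one_sub_mul_inv_one_sub_pow hx.ne,
    one_sub_mul_inv_one_sub_pow (hyx.trans_lt hx).ne]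
  have hx0 : (0 : ℝ) < κ / ν := by positivity
  have hy0 : (0 : ℝ) < k / n := by positivity
  generalize (κ : ℝ) / ν = x at *
  generalize (k : ℝ) / n = y at *
  have hSx : 0 < ∑ i ∈ Finset.range f, x ^ i := geom_sum_pos hx0.le hf.ne'
  have hSy : 0 < ∑ i ∈ Finset.range f, y ^ i := geom_sum_pos hy0.le hf.ne'
  have hS : ∑ i ∈ Finset.range f, y ^ i ≤ ∑ i ∈ Finset.range f, x ^ i := by gcongr
  rw [← div_eq_mul_inv, div_div, inv_eq_one_div, div_le_div_iff₀ (by positivity) hSy, one_mul]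
  gcongr
end
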